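/- arXiv:1105.5119 — 5 statements merged into one kernel-verified Lean document; each statement's English description precedes it below -/
import Mathlib

section
/- For every integer m ≥ 1 and every α ∈ (0,1) there is a constant C > 0 such that for every t ∈ (0,1] and every bounded function f : ℝ^m → ℝ satisfying |f(a) − f(b)| ≤ K ‖a − b‖^α for all a, b ∈ ℝ^m, the function P_t f is twice continuously differentiable and sup_{x∈ℝ^m} ( |P_t f(x)| + ‖∇(P_t f)(x)‖ + ‖D²(P_t f)(x)‖ ) ≤ C t^{-1+α/2} ( sup_{x} |f(x)| + K ). -/
open MeasureTheory Set

/-- The Euclidean heat kernel `H_t(x,y) = (4πt)^{-m/2} exp(-‖x-y‖²/(4t))` on `ℝ^m`. -/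
noncomputable def heatKernel (m : ℕ) (t : ℝ) (x y : EuclideanSpace ℝ (Fin m)) : ℝ :=
  (4 * Real.pi * t) ^ (-(m : ℝ) / 2) * Real.exp (-‖x - y‖ ^ 2 / (4 * t))

/-- The Euclidean heat operator `(P_t f)(x) = ∫ H_t(x,y) f(y) dy`. -/
noncomputable def heatOp (m : ℕ) (t : ℝ) (f : EuclideanSpace ℝ (Fin m) → ℝ)
    (x : EuclideanSpace ℝ (Fin m)) : ℝ :=
  ∫ y, heatKernel m t x y * f y

open scoped SchwartzMap ContDiff
open Filter

/-- The smoothing `x ↦ ∫ f(y) g(x-y) dy` of a scalar function `f` by a Schwartz function `g`. -/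
noncomputable def schwartzSmoothing {E F : Type*} [NormedAddCommGroup E] [NormedSpace ℝ E]
    [NormedAddCommGroup F] [NormedSpace ℝ F] [MeasurableSpace E] (μ : Measure E)
    (g : 𝓢(E, F)) (f : E → ℝ) (x : E) : F :=
  ∫ y, f y • g (x - y) ∂μ

section Gaussian

lemma one_add_pow_mul_exp_neg_sq_le (N : ℕ) {r : ℝ} (hr : 0 ≤ r) :
    (1 + r) ^ N * Real.exp (-(1 / 4) * r ^ 2) ≤ N.factorial * Real.exp 2 := by
  have h := Real.pow_div_factorial_le_exp (x := 1 + r) (by positivity) N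
  rw [div_le_iff₀' (by positivity)] at h
  calc (1 + r) ^ N * Real.exp (-(1 / 4) * r ^ 2)
      ≤ (N.factorial * Real.exp (1 + r)) * Real.exp (-(1 / 4) * r ^ 2) := by gcongr
    _ = N.factorial * Real.exp (1 + r + -(1 / 4) * r ^ 2) := by rw [mul_assoc, ← Real.exp_add]
    _ ≤ N.factorial * Real.exp 2 := by
        gcongr
        nlinarith [sq_nonneg (r - 2)]

variable (E : Type*) [NormedAddCommGroup E] [InnerProductSpace ℝ E]

lemma norm_iteratedFDeriv_exp_neg_norm_sq_decay (k n : ℕ) :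
    ∃ C : ℝ, ∀ x : E,
      ‖x‖ ^ k * ‖iteratedFDeriv ℝ n (fun z : E => Real.exp (-(1 / 4) * ‖z‖ ^ 2)) x‖ ≤ C := by
  obtain ⟨l, C, hC, hbd⟩ :=
    (Function.hasTemperateGrowth_norm_sq (H := E)).norm_iteratedFDeriv_le_uniform n
  refine ⟨n.factorial * (C + 1) ^ n * ((k + l * n).factorial * Real.exp 2), fun x => ?_⟩
  have hder := norm_iteratedFDeriv_comp_le (𝕜 := ℝ) (g := fun s : ℝ => Real.exp (-(1 / 4) * s))
    (f := fun z : E => ‖z‖ ^ 2) (n := n) (N := n) (by fun_prop) (contDiff_norm_sq ℝ) le_rfl x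
    (C := Real.exp (-(1 / 4) * ‖x‖ ^ 2)) (D := (C + 1) * (1 + ‖x‖) ^ l)
    (fun i _ => by
      rw [norm_iteratedFDeriv_eq_norm_iteratedDeriv, iteratedDeriv_exp_const_mul, norm_mul,
        norm_pow, Real.norm_of_nonneg (Real.exp_pos _).le]
      refine mul_le_of_le_one_left (Real.exp_pos _).le (pow_le_one₀ (norm_nonneg _) ?_)
      norm_num)
    (fun i hi hin => by
      refine (hbd i hin x).trans ((?_ : _ ≤ (C + 1) * (1 + ‖x‖) ^ l).trans
        (le_self_pow₀ ?_ (by lia)))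
      · gcongr; linarith
      · exact one_le_mul_of_one_le_of_one_le (by linarith) (one_le_pow₀ (by simp)))
  calc ‖x‖ ^ k * ‖iteratedFDeriv ℝ n (fun z : E => Real.exp (-(1 / 4) * ‖z‖ ^ 2)) x‖
      ≤ (1 + ‖x‖) ^ k * (n.factorial * Real.exp (-(1 / 4) * ‖x‖ ^ 2) *
          ((C + 1) * (1 + ‖x‖) ^ l) ^ n) := by
        gcongr
        · linarith
        · exact hder
    _ = n.factorial * (C + 1) ^ n *
          ((1 + ‖x‖) ^ (k + l * n) * Real.exp (-(1 / 4) * ‖x‖ ^ 2)) := by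
        rw [mul_pow, ← pow_mul, pow_add]; ring
    _ ≤ _ := by
        exact mul_le_mul_of_nonneg_left (one_add_pow_mul_exp_neg_sq_le _ (norm_nonneg x))
          (by positivity)

/-- The Gaussian `z ↦ exp(-‖z‖²/4)` as a Schwartz function. -/
noncomputable def gaussianSchwartz : 𝓢(E, ℝ) where
  toFun z := Real.exp (-(1 / 4) * ‖z‖ ^ 2)
  smooth' := by
    have := contDiff_norm_sq ℝ (E := E) (n := ∞)
    fun_prop
  decay' := norm_iteratedFDeriv_exp_neg_norm_sq_decay E

lemma gaussianSchwartz_apply (z : E) :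
    gaussianSchwartz E z = Real.exp (-(1 / 4) * ‖z‖ ^ 2) := rfl

end Gaussian

section Smoothing

variable {E F : Type*} [NormedAddCommGroup E] [NormedSpace ℝ E] [NormedAddCommGroup F]
  [NormedSpace ℝ F]

lemma SchwartzMap.exists_norm_le_rpow (g : 𝓢(E, F)) (N : ℕ) :
    ∃ C : ℝ, 0 ≤ C ∧ ∀ x, ‖g x‖ ≤ C * (1 + ‖x‖) ^ (-(N : ℝ)) := by
  refine ⟨2 ^ N * (Finset.Iic (N, 0)).sup (fun m => SchwartzMap.seminorm ℝ m.1 m.2) g,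
    by positivity, fun x => ?_⟩
  have h := SchwartzMap.one_add_le_sup_seminorm_apply (𝕜 := ℝ) (m := (N, 0)) (k := N) (n := 0)
    le_rfl le_rfl g x
  rw [norm_iteratedFDeriv_zero, ← le_div_iff₀' (by positivity)] at h
  rwa [Real.rpow_neg (by positivity), Real.rpow_natCast, ← div_eq_mul_inv]

variable [FiniteDimensional ℝ E] [MeasurableSpace E] [BorelSpace E]
  (μ : Measure E) [μ.IsAddHaarMeasure]

lemma integrable_smul_schwartz_sub (g : 𝓢(E, F)) {f : E → ℝ} (hf : Continuous f) {M : ℝ}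
    (hM : ∀ x, |f x| ≤ M) (x : E) : Integrable (fun y => f y • g (x - y)) μ :=
  (g.integrable.comp_sub_left x).bdd_smul M hf.aestronglyMeasurable
    (Eventually.of_forall hM)

lemma hasFDerivAt_schwartzSmoothing (g : 𝓢(E, F)) {f : E → ℝ} (hf : Continuous f) {M : ℝ}
    (hM : ∀ x, |f x| ≤ M) (x : E) :
    HasFDerivAt (schwartzSmoothing μ g f)
      (schwartzSmoothing μ (SchwartzMap.fderivCLM ℝ E F g) f x) x := by
  have hM0 : 0 ≤ M := (abs_nonneg _).trans (hM 0)
  set g' := SchwartzMap.fderivCLM ℝ E F g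
  set N := Module.finrank ℝ E + 1
  obtain ⟨C, hC, hg'⟩ := g'.exists_norm_le_rpow N
  refine hasFDerivAt_integral_of_dominated_of_fderiv_le
    (F := fun x y => f y • g (x - y)) (F' := fun x y => f y • g' (x - y))
    (bound := fun y => M * (C * (2 ^ N * (1 + ‖x - y‖) ^ (-(N : ℝ)))))
    (Metric.ball_mem_nhds x one_pos)
    (Eventually.of_forall fun x' =>
      (integrable_smul_schwartz_sub μ g hf hM x').aestronglyMeasurable)
    (integrable_smul_schwartz_sub μ g hf hM x)
    (integrable_smul_schwartz_sub μ g' hf hM x).aestronglyMeasurable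
    (Eventually.of_forall fun y x' hx' => ?_) ?_ (Eventually.of_forall fun y x' _ => ?_)
  · rw [norm_smul]
    have hxx : 1 + ‖x - y‖ ≤ 2 * (1 + ‖x' - y‖) := by
      have h1 : ‖x - y‖ ≤ ‖x - x'‖ + ‖x' - y‖ := norm_sub_le_norm_sub_add_norm_sub _ _ _
      have h2 : ‖x - x'‖ < 1 := by simpa [dist_eq_norm, norm_sub_rev] using hx'
      linarith [norm_nonneg (x' - y)]
    gcongr
    · exact hM y
    · refine (hg' _).trans ?_
      gcongr
      rw [Real.rpow_neg (by positivity), Real.rpow_neg (by positivity), Real.rpow_natCast,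
        Real.rpow_natCast, ← div_eq_mul_inv, le_div_iff₀ (by positivity),
        inv_mul_le_iff₀ (by positivity), ← mul_pow, mul_comm]
      gcongr
  · have := (integrable_one_add_norm (μ := μ) (E := E) (r := N) (by simp [N])).comp_sub_left x
    exact ((this.const_mul _).const_mul _).const_mul _
  · have h := (g.hasFDerivAt (x' - y)).comp x' ((hasFDerivAt_id x').sub_const y)
    exact h.const_smul (f y)

lemma fderiv_schwartzSmoothing (g : 𝓢(E, F)) {f : E → ℝ} (hf : Continuous f) {M : ℝ}
    (hM : ∀ x, |f x| ≤ M) :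
    fderiv ℝ (schwartzSmoothing μ g f) =
      schwartzSmoothing μ (SchwartzMap.fderivCLM ℝ E F g) f :=
  funext fun x => (hasFDerivAt_schwartzSmoothing μ g hf hM x).fderiv

lemma differentiable_schwartzSmoothing (g : 𝓢(E, F)) {f : E → ℝ} (hf : Continuous f) {M : ℝ}
    (hM : ∀ x, |f x| ≤ M) : Differentiable ℝ (schwartzSmoothing μ g f) :=
  fun x => (hasFDerivAt_schwartzSmoothing μ g hf hM x).differentiableAt

lemma contDiff_two_schwartzSmoothing (g : 𝓢(E, F)) {f : E → ℝ} (hf : Continuous f) {M : ℝ}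
    (hM : ∀ x, |f x| ≤ M) : ContDiff ℝ 2 (schwartzSmoothing μ g f) := by
  rw [show (2 : WithTop ℕ∞) = 1 + 1 from one_add_one_eq_two.symm, contDiff_succ_iff_fderiv]
  refine ⟨differentiable_schwartzSmoothing μ g hf hM, by simp, ?_⟩
  rw [fderiv_schwartzSmoothing μ g hf hM, contDiff_one_iff_fderiv,
    fderiv_schwartzSmoothing μ _ hf hM]
  exact ⟨differentiable_schwartzSmoothing μ _ hf hM,
    (differentiable_schwartzSmoothing μ _ hf hM).continuous⟩

lemma norm_schwartzSmoothing_le (g : 𝓢(E, F)) {f : E → ℝ} {M : ℝ}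
    (hM : ∀ x, |f x| ≤ M) (x : E) :
    ‖schwartzSmoothing μ g f x‖ ≤ M * ∫ z, ‖g z‖ ∂μ := by
  calc ‖schwartzSmoothing μ g f x‖ ≤ ∫ y, M * ‖g (x - y)‖ ∂μ := by
        refine norm_integral_le_of_norm_le ((g.integrable.norm.comp_sub_left x).const_mul M)
          (Eventually.of_forall fun y => ?_)
        rw [norm_smul]
        gcongr
        exact hM y
    _ = M * ∫ z, ‖g z‖ ∂μ := by
        rw [integral_const_mul, integral_sub_left_eq_self (fun z => ‖g z‖) μ x]

lemma schwartzSmoothing_const_one (g : 𝓢(E, F)) (x : E) :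
    schwartzSmoothing μ g (fun _ => 1) x = ∫ z, g z ∂μ := by
  simp only [schwartzSmoothing, one_smul]
  exact integral_sub_left_eq_self (fun z => g z) μ x

lemma integral_fderivCLM_eq_zero (g : 𝓢(E, F)) :
    ∫ z, SchwartzMap.fderivCLM ℝ E F g z ∂μ = 0 := by
  rw [← schwartzSmoothing_const_one μ _ 0,
    ← fderiv_schwartzSmoothing μ g continuous_const (M := 1) (by simp),
    funext (schwartzSmoothing_const_one μ g)]
  simp

/-- The gain from the cancellation `∫ g = 0`: subtracting `f x` inside the integral. -/
lemma norm_schwartzSmoothing_le_of_holder (g : 𝓢(E, F)) (hg : ∫ z, g z ∂μ = 0) {f : E → ℝ}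
    (hf : Continuous f) {M : ℝ} (hM : ∀ x, |f x| ≤ M) {α K : ℝ} (hα : α ∈ Ioo (0 : ℝ) 1)
    (hK : ∀ a b, |f a - f b| ≤ K * ‖a - b‖ ^ α) (x : E) :
    ‖schwartzSmoothing μ g f x‖ ≤ K * ∫ z, ‖z‖ ^ α * ‖g z‖ ∂μ := by
  have hint : Integrable (fun z => ‖z‖ ^ α * ‖g z‖) μ := by
    refine ((g.integrable.norm).add (by simpa using g.integrable_pow_mul μ 1)).mono'
      (g := fun z => ‖g z‖ + ‖z‖ * ‖g z‖) ?_ (Eventually.of_forall fun z => ?_)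
    · exact ((continuous_norm.rpow_const fun _ => Or.inr hα.1.le).mul
        g.continuous.norm).aestronglyMeasurable
    · rw [Real.norm_of_nonneg (by positivity), ← one_add_mul]
      gcongr
      rcases le_total ‖z‖ 1 with h | h
      · linarith [Real.rpow_le_one (norm_nonneg z) h hα.1.le, norm_nonneg z]
      · linarith [Real.rpow_le_self_of_one_le h hα.2.le]
  have hsub : schwartzSmoothing μ g f x = ∫ y, (f y - f x) • g (x - y) ∂μ := by
    simp only [sub_smul]
    rw [integral_sub (integrable_smul_schwartz_sub μ g hf hM x)
      ((g.integrable.comp_sub_left x).fun_smul (f x)), integral_smul,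
      integral_sub_left_eq_self (fun z => g z) μ x, hg, smul_zero, sub_zero]
    rfl
  rw [hsub]
  calc ‖∫ y, (f y - f x) • g (x - y) ∂μ‖ ≤ ∫ y, K * (‖x - y‖ ^ α * ‖g (x - y)‖) ∂μ := by
        refine norm_integral_le_of_norm_le ((hint.comp_sub_left x).const_mul K)
          (Eventually.of_forall fun y => ?_)
        rw [norm_smul, ← mul_assoc, norm_sub_rev x y]
        gcongr
        exact hK y x
    _ = K * ∫ z, ‖z‖ ^ α * ‖g z‖ ∂μ := by
        rw [integral_const_mul, integral_sub_left_eq_self (fun z => ‖z‖ ^ α * ‖g z‖) μ x]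

end Smoothing

lemma continuous_of_abs_sub_le_rpow {E : Type*} [SeminormedAddCommGroup E] {f : E → ℝ} {α K : ℝ}
    (hα : 0 < α) (hK : ∀ a b, |f a - f b| ≤ K * ‖a - b‖ ^ α) : Continuous f := by
  refine continuous_iff_continuousAt.2 fun x => ?_
  rw [ContinuousAt, tendsto_iff_norm_sub_tendsto_zero]
  refine squeeze_zero (fun _ => norm_nonneg _) (fun y => hK y x) ?_
  have h : Continuous fun y : E => K * ‖y - x‖ ^ α :=
    continuous_const.mul ((continuous_id.sub continuous_const).norm.rpow_const
      fun _ => Or.inr hα.le)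
  simpa [Real.zero_rpow hα.ne'] using h.tendsto x

lemma heatOp_eq_schwartzSmoothing (m : ℕ) {t : ℝ} (ht : 0 < t)
    (f : EuclideanSpace ℝ (Fin m) → ℝ) :
    heatOp m t f = fun x => schwartzSmoothing volume
      ((4 * Real.pi) ^ (-(m : ℝ) / 2) • gaussianSchwartz (EuclideanSpace ℝ (Fin m)))
      (fun u => f (√t • u)) ((√t)⁻¹ • x) := by
  have hs : 0 < √t := Real.sqrt_pos.2 ht
  have hpow : t ^ (-(m : ℝ) / 2) = (√t ^ m)⁻¹ := by
    rw [Real.sqrt_eq_rpow, ← Real.rpow_natCast, ← Real.rpow_mul ht.le, ← Real.rpow_neg ht.le]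
    congr 1; ring
  funext x
  have key := Measure.integral_comp_smul_of_nonneg volume
    (fun y => heatKernel m t x y * f y) (√t) (hR := hs.le)
  rw [finrank_euclideanSpace_fin, smul_eq_mul, eq_inv_mul_iff_mul_eq₀ (pow_pos hs m).ne',
    ← integral_const_mul] at key
  rw [heatOp, ← key, schwartzSmoothing]
  refine integral_congr_ae (Eventually.of_forall fun u => ?_)
  have hnorm : ‖(√t)⁻¹ • x - u‖ ^ 2 = ‖x - √t • u‖ ^ 2 / t := by
    have : (√t)⁻¹ • x - u = (√t)⁻¹ • (x - √t • u) := by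
      rw [smul_sub, inv_smul_smul₀ hs.ne']
    rw [this, norm_smul, mul_pow, norm_inv, inv_pow, Real.norm_of_nonneg hs.le, Real.sq_sqrt ht.le]
    ring
  simp only [heatKernel, smul_apply, gaussianSchwartz_apply, smul_eq_mul, hnorm]
  rw [Real.mul_rpow (by positivity) ht.le, hpow,
    show -(1 / 4) * (‖x - √t • u‖ ^ 2 / t) = -‖x - √t • u‖ ^ 2 / (4 * t) by field_simp]
  field_simp

/-- **Hölder estimate `e^{-tΔ} : C^α → C²` with bound `C t^{-1+α/2}` in the Euclidean
model.** For `m ≥ 1`, `α ∈ (0,1)` there is `C > 0` such that for `t ∈ (0,1]` and every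
bounded `α`-Hölder function `f` (with Hölder constant `K`), `P_t f` is `C²` and
`sup (|P_t f| + ‖∇ P_t f‖ + ‖D² P_t f‖) ≤ C t^{-1+α/2} (sup |f| + K)`. -/
theorem heatOp_holder_to_C2 (m : ℕ) (hm : 1 ≤ m) (α : ℝ) (hα : α ∈ Ioo (0:ℝ) 1) :
    ∃ C : ℝ, 0 < C ∧ ∀ t ∈ Ioc (0:ℝ) 1, ∀ f : EuclideanSpace ℝ (Fin m) → ℝ, ∀ K : ℝ,
      (∃ M : ℝ, ∀ x, |f x| ≤ M) →
      (∀ a b, |f a - f b| ≤ K * ‖a - b‖ ^ α) →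
      ContDiff ℝ 2 (heatOp m t f) ∧
      ∀ x, |heatOp m t f x| + ‖fderiv ℝ (heatOp m t f) x‖ +
          ‖iteratedFDeriv ℝ 2 (heatOp m t f) x‖ ≤
        C * t ^ (-1 + α / 2) * ((⨆ x', |f x'|) + K) := by
  set E := EuclideanSpace ℝ (Fin m)
  set g : 𝓢(E, ℝ) := (4 * Real.pi) ^ (-(m : ℝ) / 2) • gaussianSchwartz E
  set g₁ := SchwartzMap.fderivCLM ℝ E ℝ g with hg₁
  set g₂ := SchwartzMap.fderivCLM ℝ E (E →L[ℝ] ℝ) g₁ with hg₂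
  set A₀ := ∫ z, ‖g z‖
  set A₁ := ∫ z, ‖z‖ ^ α * ‖g₁ z‖
  set A₂ := ∫ z, ‖z‖ ^ α * ‖g₂ z‖
  have hA₀ : 0 ≤ A₀ := by positivity
  have hA₁ : 0 ≤ A₁ := by positivity
  have hA₂ : 0 ≤ A₂ := by positivity
  refine ⟨A₀ + A₁ + A₂ + 1, by positivity, fun t ht f K ⟨M, hM⟩ hK => ?_⟩
  have hs : 0 < √t := Real.sqrt_pos.2 ht.1
  have hK0 : 0 ≤ K := by
    have : Nonempty (Fin m) := ⟨⟨0, hm⟩⟩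
    obtain ⟨v, hv⟩ := exists_ne (0 : E)
    have h := (abs_nonneg _).trans (hK v 0)
    rw [sub_zero] at h
    exact nonneg_of_mul_nonneg_left h (Real.rpow_pos_of_pos (norm_pos_iff.2 hv) _)
  set S := ⨆ x', |f x'|
  have hS (x) : |f x| ≤ S := le_ciSup ⟨M, by rintro _ ⟨x, rfl⟩; exact hM x⟩ x
  have hS0 : 0 ≤ S := (abs_nonneg _).trans (hS 0)
  set F : E → ℝ := fun u => f (√t • u)
  have hFS (u) : |F u| ≤ S := hS _
  have hFc : Continuous F :=
    (continuous_of_abs_sub_le_rpow hα.1 hK).comp (continuous_const_smul (√t))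
  have hFK (a b) : |F a - F b| ≤ (K * √t ^ α) * ‖a - b‖ ^ α := by
    refine (hK _ _).trans_eq ?_
    rw [← smul_sub, norm_smul, Real.norm_of_nonneg hs.le,
      Real.mul_rpow hs.le (norm_nonneg _), mul_assoc]
  set u := schwartzSmoothing volume g F
  have hu : ContDiff ℝ 2 u := contDiff_two_schwartzSmoothing volume g hFc hFS
  have heq : heatOp m t f = fun x => u ((√t)⁻¹ • x) := heatOp_eq_schwartzSmoothing m ht.1 f
  have hu₁ : fderiv ℝ u = schwartzSmoothing volume g₁ F :=
    fderiv_schwartzSmoothing volume g hFc hFS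
  have hu₂ : fderiv ℝ (fderiv ℝ u) = schwartzSmoothing volume g₂ F := by
    rw [hu₁, fderiv_schwartzSmoothing volume g₁ hFc hFS]
  rw [heq]
  refine ⟨hu.comp (contDiff_const_smul _), fun x => ?_⟩
  set p := t ^ (-1 + α / 2) with hp
  have hp0 : 0 ≤ p := Real.rpow_nonneg ht.1.le _
  have hp_one : 1 ≤ p := Real.one_le_rpow_of_pos_of_le_one_of_nonpos ht.1 ht.2 (by linarith [hα.2])
  have hp₂ : (√t)⁻¹ ^ 2 * √t ^ α = p := by
    rw [inv_pow, Real.sq_sqrt ht.1.le, Real.sqrt_eq_rpow, ← Real.rpow_mul ht.1.le, hp,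
      Real.rpow_add ht.1, Real.rpow_neg_one]
    congr 2; ring
  have hinv : 1 ≤ (√t)⁻¹ := (one_le_inv₀ hs).2 (Real.sqrt_le_one.2 ht.2)
  have hp₁ : (√t)⁻¹ * √t ^ α ≤ p := by
    rw [← hp₂]
    gcongr
    exact le_self_pow₀ hinv two_ne_zero
  have h₀ : |u ((√t)⁻¹ • x)| ≤ A₀ * p * (S + K) := by
    calc |u ((√t)⁻¹ • x)| ≤ S * A₀ := norm_schwartzSmoothing_le volume g hFS _
      _ = A₀ * 1 * (S + 0) := by ring
      _ ≤ A₀ * p * (S + K) := by gcongr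
  have h₁ : ‖fderiv ℝ (fun x => u ((√t)⁻¹ • x)) x‖ ≤ A₁ * p * (S + K) := by
    rw [fderiv_comp_smul, norm_smul, Real.norm_of_nonneg (by positivity), hu₁]
    calc (√t)⁻¹ * ‖schwartzSmoothing volume g₁ F ((√t)⁻¹ • x)‖
        ≤ (√t)⁻¹ * (K * √t ^ α * A₁) := by
          gcongr
          exact norm_schwartzSmoothing_le_of_holder volume g₁
            (integral_fderivCLM_eq_zero volume g) hFc hFS hα hFK _
      _ = A₁ * ((√t)⁻¹ * √t ^ α) * (0 + K) := by ring
      _ ≤ A₁ * p * (S + K) := by gcongr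
  have h₂ : ‖iteratedFDeriv ℝ 2 (fun x => u ((√t)⁻¹ • x)) x‖ ≤ A₂ * p * (S + K) := by
    rw [iteratedFDeriv_comp_const_smul _ hu, norm_smul, Real.norm_of_nonneg (by positivity),
      ← norm_iteratedFDeriv_fderiv, norm_iteratedFDeriv_one, hu₂]
    calc (√t)⁻¹ ^ 2 * ‖schwartzSmoothing volume g₂ F ((√t)⁻¹ • x)‖
        ≤ (√t)⁻¹ ^ 2 * (K * √t ^ α * A₂) := by
          gcongr
          exact norm_schwartzSmoothing_le_of_holder volume g₂
            (integral_fderivCLM_eq_zero volume g₁) hFc hFS hα hFK _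
      _ = A₂ * ((√t)⁻¹ ^ 2 * √t ^ α) * (0 + K) := by ring
      _ ≤ A₂ * p * (S + K) := by rw [hp₂]; gcongr
  have h₃ : 0 ≤ p * (S + K) := by positivity
  linarith
end

section
/- Let m ≥ 1 and k ∈ ℕ, and let f : ℝ^m → ℝ be k-times continuously differentiable such that for every j ≤ k the iterated derivative D^j f is bounded and uniformly continuous on ℝ^m. Then Σ_{j=0}^{k} sup_{x∈ℝ^m} ‖D^j (P_t f)(x) − D^j f(x)‖ → 0 as t → 0⁺; that is, the heat semigroup P_t is strongly continuous on the space of functions with bounded uniformly continuous derivatives up to order k, equipped with the norm Σ_{j≤k} sup ‖D^j · ‖. -/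
open MeasureTheory Set

section Averages

variable {E F : Type*} [NormedAddCommGroup E] [SecondCountableTopology E]
  [MeasurableSpace E] [BorelSpace E] [NormedAddCommGroup F] [NormedSpace ℝ F]
  {μ : Measure E} {K : E → ℝ} {M : ℝ}

/-- A bounded continuous function, translated, is integrable against an integrable weight. -/
theorem MeasureTheory.Integrable.smul_translate_of_bounded (hK : Integrable K μ) {g : E → F}
    (hg : Continuous g) (hM : ∀ x, ‖g x‖ ≤ M) (x : E) :
    Integrable (fun z ↦ K z • g (x + z)) μ :=
  hK.smul_bdd M (by fun_prop : Continuous fun z ↦ g (x + z)).aestronglyMeasurable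
    (.of_forall fun _ ↦ hM _)

variable [NormedSpace ℝ E]

/-- A weighted average of translates may be differentiated under the integral sign. -/
theorem hasFDerivAt_integral_smul_translate (hK : Integrable K μ) {g : E → F} {M' : ℝ}
    (hg : Differentiable ℝ g) (hM : ∀ x, ‖g x‖ ≤ M) (hg' : Continuous (fderiv ℝ g))
    (hM' : ∀ x, ‖fderiv ℝ g x‖ ≤ M') (x : E) :
    HasFDerivAt (fun x ↦ ∫ z, K z • g (x + z) ∂μ) (∫ z, K z • fderiv ℝ g (x + z) ∂μ) x := by
  refine hasFDerivAt_integral_of_dominated_of_fderiv_le (s := univ)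
    (F' := fun y z ↦ K z • fderiv ℝ g (y + z)) (bound := fun z ↦ ‖K z‖ * M')
    Filter.univ_mem
    (.of_forall fun y ↦ (hK.smul_translate_of_bounded hg.continuous hM y).aestronglyMeasurable)
    (hK.smul_translate_of_bounded hg.continuous hM x)
    (hK.smul_translate_of_bounded hg' hM' x).aestronglyMeasurable
    (.of_forall fun z y _ ↦ ?_) (hK.norm.mul_const M') (.of_forall fun z y _ ↦ ?_)
  · rw [norm_smul]
    gcongr
    exact hM' _
  · exact ((hasFDerivAt_comp_add_right z).2 (hg (y + z)).hasFDerivAt).const_smul (K z)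

/-- Iterated derivatives commute with weighted averages of translates. -/
theorem iteratedFDeriv_integral_smul_translate (hK : Integrable K μ)
    {f : E → F} {k : ℕ} (hf : ContDiff ℝ k f)
    (hbd : ∀ j ≤ k, ∃ M : ℝ, ∀ x, ‖iteratedFDeriv ℝ j f x‖ ≤ M) {j : ℕ} (hj : j ≤ k) :
    iteratedFDeriv ℝ j (fun x ↦ ∫ z, K z • f (x + z) ∂μ) =
      fun x ↦ ∫ z, K z • iteratedFDeriv ℝ j f (x + z) ∂μ := by
  induction j with
  | zero =>
    ext1 x
    simp only [iteratedFDeriv_zero_eq_comp, Function.comp_apply, ← map_smul]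
    exact ((continuousMultilinearCurryFin0 ℝ E F).symm.toContinuousLinearEquiv.integral_comp_comm
      _).symm
  | succ j ih =>
    ext1 x
    obtain ⟨M, hM⟩ := hbd j (by lia)
    obtain ⟨M', hM'⟩ := hbd (j + 1) hj
    have hd : HasFDerivAt _ _ x := hasFDerivAt_integral_smul_translate hK
      (hf.differentiable_iteratedFDeriv (m := j) (by exact_mod_cast hj)) hM
      ((hf.iteratedFDeriv_right (m := 1) (i := j)
        (by norm_cast; lia)).continuous_fderiv one_ne_zero)
      (fun y ↦ (norm_fderiv_iteratedFDeriv (𝕜 := ℝ) (f := f) (x := y) (n := j)).trans_le (hM' y)) x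
    rw [iteratedFDeriv_succ_eq_comp_left, Function.comp_apply, ih (by lia), hd.fderiv]
    simp only [iteratedFDeriv_succ_eq_comp_left, Function.comp_apply, ← map_smul]
    exact (ContinuousLinearEquiv.integral_comp_comm (𝕜 := ℝ) (μ := μ)
      (E := E →L[ℝ] E [×j]→L[ℝ] F) (F := E [×(j + 1)]→L[ℝ] F)
      (continuousMultilinearCurryLeftEquiv ℝ
        (fun _ : Fin (j + 1) ↦ E) F).symm.toContinuousLinearEquiv _).symm

end Averages

section HeatKernel

variable {m : ℕ} {t : ℝ}

theorem heatKernel_nonneg (ht : 0 ≤ t) (x y : EuclideanSpace ℝ (Fin m)) :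
    0 ≤ heatKernel m t x y := by
  unfold heatKernel
  positivity

theorem integral_heatKernel_zero (ht : 0 < t) : ∫ z, heatKernel m t 0 z = 1 := by
  have h := GaussianFourier.integral_rexp_neg_mul_sq_norm (V := EuclideanSpace ℝ (Fin m))
    (b := 1 / (4 * t)) (by positivity)
  have hexp : ∀ z : EuclideanSpace ℝ (Fin m),
      -‖(0 : EuclideanSpace ℝ (Fin m)) - z‖ ^ 2 / (4 * t) = -(1 / (4 * t)) * ‖z‖ ^ 2 := by
    intro z
    rw [zero_sub, norm_neg]
    ring
  simp only [heatKernel, hexp]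
  rw [integral_const_mul, h, finrank_euclideanSpace_fin,
    show Real.pi / (1 / (4 * t)) = 4 * Real.pi * t by field_simp,
    ← Real.rpow_add (by positivity), neg_div, neg_add_cancel, Real.rpow_zero]

theorem integrable_heatKernel_zero (ht : 0 < t) : Integrable (heatKernel m t 0) :=
  Integrable.of_integral_ne_zero (by rw [integral_heatKernel_zero ht]; exact one_ne_zero)

theorem heatOp_eq_integral_translate (f : EuclideanSpace ℝ (Fin m) → ℝ) :
    heatOp m t f = fun x ↦ ∫ z, heatKernel m t 0 z • f (x + z) := by
  ext x
  rw [heatOp, ← integral_add_left_eq_self _ x]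
  simp [heatKernel]

/-- Away from the origin, the heat kernel is dominated by a small multiple of the heat kernel at
twice the time. -/
theorem heatKernel_zero_le_of_le_norm (ht : 0 < t) {δ : ℝ} (hδ : 0 < δ)
    {z : EuclideanSpace ℝ (Fin m)} (hz : δ ≤ ‖z‖) :
    heatKernel m t 0 z ≤ 2 ^ ((m : ℝ) / 2) * (8 * t / δ ^ 2) * heatKernel m (2 * t) 0 z := by
  have hexp : Real.exp (-(δ ^ 2 / (8 * t))) ≤ 8 * t / δ ^ 2 := by
    rw [Real.exp_neg, ← inv_div (δ ^ 2) (8 * t)]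
    gcongr
    linarith [Real.add_one_le_exp (δ ^ 2 / (8 * t))]
  have hsplit : Real.exp (-‖z‖ ^ 2 / (4 * t)) ≤
      Real.exp (-(δ ^ 2 / (8 * t))) * Real.exp (-‖z‖ ^ 2 / (4 * (2 * t))) := by
    rw [← Real.exp_add, Real.exp_le_exp]
    have : δ ^ 2 / (8 * t) ≤ ‖z‖ ^ 2 / (8 * t) := by gcongr
    have h4 : -‖z‖ ^ 2 / (4 * t) = -(2 * (‖z‖ ^ 2 / (8 * t))) := by field_simp; ring
    have h8 : -‖z‖ ^ 2 / (4 * (2 * t)) = -(‖z‖ ^ 2 / (8 * t)) := by ring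
    rw [h4, h8]
    linarith
  have hpow : (4 * Real.pi * t) ^ (-(m : ℝ) / 2) =
      2 ^ ((m : ℝ) / 2) * (4 * Real.pi * (2 * t)) ^ (-(m : ℝ) / 2) := by
    rw [show 4 * Real.pi * (2 * t) = 2 * (4 * Real.pi * t) by ring,
      Real.mul_rpow (x := 2) (by norm_num) (by positivity), ← mul_assoc, ← Real.rpow_add (by norm_num),
      neg_div, add_neg_cancel, Real.rpow_zero, one_mul]
  simp only [heatKernel, zero_sub, norm_neg]
  calc _ ≤ (4 * Real.pi * t) ^ (-(m : ℝ) / 2) *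
        (8 * t / δ ^ 2 * Real.exp (-‖z‖ ^ 2 / (4 * (2 * t)))) := by
        gcongr
        exact hsplit.trans (by gcongr)
    _ = _ := by rw [hpow]; ring

/-- The heat kernel is an approximate identity, uniformly on bounded uniformly continuous
functions. -/
theorem exists_norm_integral_heatKernel_smul_translate_sub_le {F : Type*} [NormedAddCommGroup F]
    [NormedSpace ℝ F] [CompleteSpace F] {g : EuclideanSpace ℝ (Fin m) → F} {M : ℝ}
    (hM : ∀ x, ‖g x‖ ≤ M) (hg : UniformContinuous g) {ε : ℝ} (hε : 0 < ε) :
    ∃ t₀ > 0, ∀ t ∈ Ioc (0 : ℝ) t₀, ∀ x,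
      ‖(∫ z, heatKernel m t 0 z • g (x + z)) - g x‖ ≤ ε := by
  obtain ⟨δ, hδ, hgδ⟩ := Metric.uniformContinuous_iff.1 hg (ε / 2) (half_pos hε)
  have hM0 : 0 ≤ M := (norm_nonneg _).trans (hM 0)
  set C : ℝ := 2 * M * 2 ^ ((m : ℝ) / 2) * (8 / δ ^ 2) with hC
  have hC0 : 0 ≤ C := by positivity
  refine ⟨ε / 2 / (C + 1), by positivity, fun t ⟨ht, ht₀⟩ x ↦ ?_⟩
  have hK := integrable_heatKernel_zero (m := m) ht
  have hK2 := integrable_heatKernel_zero (m := m) (t := 2 * t) (by positivity)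
  have hconst : g x = ∫ z, heatKernel m t 0 z • g x := by
    rw [integral_smul_const, integral_heatKernel_zero ht, one_smul]
  have hpt (z : EuclideanSpace ℝ (Fin m)) :
      ‖heatKernel m t 0 z • g (x + z) - heatKernel m t 0 z • g x‖ ≤
        ε / 2 * heatKernel m t 0 z + C * t * heatKernel m (2 * t) 0 z := by
    have h1 := heatKernel_nonneg (m := m) ht.le 0 z
    have h2 := heatKernel_nonneg (m := m) (t := 2 * t) (by positivity) 0 z
    rw [← smul_sub, norm_smul, Real.norm_of_nonneg h1]
    rcases lt_or_ge ‖z‖ δ with hz | hz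
    · have h3 : ‖g (x + z) - g x‖ < ε / 2 := by
        rw [← dist_eq_norm]
        exact hgδ (by simpa [dist_eq_norm] using hz)
      nlinarith [mul_nonneg (mul_nonneg hC0 ht.le) h2]
    · have h3 : ‖g (x + z) - g x‖ ≤ 2 * M := by
        linarith [norm_sub_le (g (x + z)) (g x), hM (x + z), hM x]
      calc _ ≤ (2 ^ ((m : ℝ) / 2) * (8 * t / δ ^ 2) * heatKernel m (2 * t) 0 z) * (2 * M) :=
            mul_le_mul (heatKernel_zero_le_of_le_norm ht hδ hz) h3 (norm_nonneg _)
              (by positivity)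
        _ = C * t * heatKernel m (2 * t) 0 z := by rw [hC]; ring
        _ ≤ _ := le_add_of_nonneg_left (by positivity)
  calc ‖(∫ z, heatKernel m t 0 z • g (x + z)) - g x‖
      = ‖∫ z, (heatKernel m t 0 z • g (x + z) - heatKernel m t 0 z • g x)‖ := by
        rw [integral_sub (hK.smul_translate_of_bounded hg.continuous hM x) (hK.smul_const _),
          ← hconst]
    _ ≤ ∫ z, (ε / 2 * heatKernel m t 0 z + C * t * heatKernel m (2 * t) 0 z) :=
        norm_integral_le_of_norm_le ((hK.const_mul _).add (hK2.const_mul _)) (.of_forall hpt)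
    _ = ε / 2 + C * t := by
        rw [integral_add (hK.const_mul _) (hK2.const_mul _), integral_const_mul,
          integral_const_mul, integral_heatKernel_zero ht,
          integral_heatKernel_zero (by positivity), mul_one, mul_one]
    _ ≤ ε := by
        rw [le_div_iff₀ (by positivity)] at ht₀
        linarith

end HeatKernel

/-- **Strong continuity of the heat semigroup in `C^k`-norm (Euclidean model).**
If `f` is `C^k` with bounded, uniformly continuous derivatives up to order `k`, then
`Σ_{j≤k} sup_x ‖D^j (P_t f)(x) − D^j f(x)‖ → 0` as `t → 0⁺`. -/
theorem heatOp_strong_continuity_Ck (m : ℕ) (hm : 1 ≤ m) (k : ℕ)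
    (f : EuclideanSpace ℝ (Fin m) → ℝ)
    (hf : ContDiff ℝ k f)
    (hbd : ∀ j ≤ k, ∃ M : ℝ, ∀ x, ‖iteratedFDeriv ℝ j f x‖ ≤ M)
    (huc : ∀ j ≤ k, UniformContinuous (iteratedFDeriv ℝ j f)) :
    ∀ ε > 0, ∃ t₀ > 0, ∀ t ∈ Ioc (0:ℝ) t₀, ∀ x,
      ∑ j ∈ Finset.range (k + 1),
        ‖iteratedFDeriv ℝ j (heatOp m t f) x - iteratedFDeriv ℝ j f x‖ ≤ ε := by
  intro ε hε
  have key (j : ℕ) (hj : j ∈ Finset.range (k + 1)) : ∀ᶠ t in nhdsWithin (0 : ℝ) (Ioi 0), ∀ x,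
      ‖iteratedFDeriv ℝ j (heatOp m t f) x - iteratedFDeriv ℝ j f x‖ ≤ ε / (k + 1) := by
    have hjk : j ≤ k := Finset.mem_range_succ_iff.1 hj
    obtain ⟨M, hM⟩ := hbd j hjk
    obtain ⟨t₀, ht₀, h⟩ := exists_norm_integral_heatKernel_smul_translate_sub_le hM (huc j hjk)
      (show 0 < ε / (k + 1) by positivity)
    filter_upwards [Ioc_mem_nhdsGT ht₀] with t ht x
    rw [heatOp_eq_integral_translate,
      iteratedFDeriv_integral_smul_translate (integrable_heatKernel_zero ht.1) hf hbd hjk]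
    exact h t ht x
  obtain ⟨t₀, ht₀, h⟩ :=
    mem_nhdsGT_iff_exists_Ioc_subset.1 ((Finset.eventually_all _).2 key)
  refine ⟨t₀, ht₀, fun t ht x ↦ ?_⟩
  calc _ ≤ ∑ _j ∈ Finset.range (k + 1), ε / (k + 1) :=
        Finset.sum_le_sum fun j hj ↦ h ht j hj x
    _ = ε := by
        rw [Finset.sum_const, Finset.card_range, nsmul_eq_mul]
        push_cast
        field_simp
end

section
/- For every w ∈ ℝ and every n ∈ ℕ there is a constant C > 0 such that for all t ∈ (0,1] and every continuous f : (0,∞) → ℝ with sup_{x>0} x^{-w}|f(x)| < ∞, the function E_t f is smooth on (0,∞) and sup_{x>0} x^{-w} | ((x·d/dx)^n (E_t f))(x) | ≤ C t^{-n/2} sup_{x>0} x^{-w} |f(x)|, where (x·d/dx)^n denotes the n-fold composition of the operator g ↦ x g'(x). -/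
open MeasureTheory Set

/-- The b-heat kernel `H^b_t(x,x̃) = (4πt)^{-1/2} exp(-(log(x/x̃))²/(4t))` of the complete
b-metric `dx²/x²` on `(0,∞)`. -/
noncomputable def bHeatKernel (t x y : ℝ) : ℝ :=
  (4 * Real.pi * t) ^ (-(1:ℝ) / 2) * Real.exp (-(Real.log (x / y)) ^ 2 / (4 * t))

/-- The b-heat operator `(E_t f)(x) = ∫₀^∞ H^b_t(x,x̃) f(x̃) dx̃/x̃`. -/
noncomputable def bHeatOp (t : ℝ) (f : ℝ → ℝ) (x : ℝ) : ℝ :=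
  ∫ y in Ioi (0:ℝ), bHeatKernel t x y * f y / y

/-- The edge vector field `x·d/dx` acting on functions on `(0,∞)`. -/
noncomputable def xDdx (g : ℝ → ℝ) : ℝ → ℝ := fun x => x * deriv g x

section

open Polynomial Filter Topology

/-- A polynomial times the standard Gaussian profile. -/
noncomputable def polyGaussian (p : ℝ[X]) (z : ℝ) : ℝ :=
  p.eval z * Real.exp (-z ^ 2 / 2)

/-- The polynomial part of the derivative of `polyGaussian p`. -/
noncomputable def polyGaussianDeriv (p : ℝ[X]) : ℝ[X] :=
  derivative p - X * p

/-- Convolution of `φ` with `polyGaussian p` rescaled to width `σ`. -/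
noncomputable def gaussianConv (σ : ℝ) (φ : ℝ → ℝ) (p : ℝ[X]) (s : ℝ) : ℝ :=
  ∫ v, polyGaussian p ((s - v) / σ) * φ v

theorem continuous_polyGaussian (p : ℝ[X]) : Continuous (polyGaussian p) := by
  unfold polyGaussian
  fun_prop

theorem hasDerivAt_polyGaussian (p : ℝ[X]) (z : ℝ) :
    HasDerivAt (polyGaussian p) (polyGaussian (polyGaussianDeriv p) z) z := by
  have h : HasDerivAt (fun z : ℝ => -z ^ 2 / 2) (-z) z := by
    exact ((hasDerivAt_pow 2 z).neg.div_const 2).congr_deriv (by simp; ring)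
  refine ((p.hasDerivAt z).mul h.exp).congr_deriv ?_
  simp only [polyGaussian, polyGaussianDeriv, eval_sub, eval_mul, eval_X]
  ring

theorem exists_abs_eval_le_exp_abs (p : ℝ[X]) :
    ∃ A : ℝ, 0 ≤ A ∧ ∀ z : ℝ, |p.eval z| ≤ A * Real.exp |z| := by
  refine ⟨∑ i ∈ p.support, |p.coeff i| * i.factorial, by positivity, fun z => ?_⟩
  rw [eval_eq_sum, Polynomial.sum, Finset.sum_mul]
  refine (Finset.abs_sum_le_sum_abs _ _).trans (Finset.sum_le_sum fun i _ => ?_)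
  have h := Real.pow_div_factorial_le_exp |z| (abs_nonneg z) i
  rw [div_le_iff₀ (by positivity)] at h
  rw [abs_mul, abs_pow, mul_assoc, mul_comm (i.factorial : ℝ)]
  gcongr

theorem exists_abs_polyGaussian_le_exp (p : ℝ[X]) (a : ℝ) :
    ∃ A : ℝ, 0 ≤ A ∧ ∀ z : ℝ, |polyGaussian p z| ≤ A * Real.exp (-(a * |z|)) := by
  obtain ⟨A, hA, h⟩ := exists_abs_eval_le_exp_abs p
  refine ⟨A * Real.exp ((a + 1) ^ 2 / 2), by positivity, fun z => ?_⟩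
  rw [polyGaussian, abs_mul, Real.abs_exp]
  calc |p.eval z| * Real.exp (-z ^ 2 / 2)
      ≤ A * Real.exp |z| * Real.exp (-z ^ 2 / 2) := by gcongr; exact h z
    _ = A * Real.exp (|z| + -z ^ 2 / 2) := by rw [mul_assoc, ← Real.exp_add]
    _ ≤ A * Real.exp ((a + 1) ^ 2 / 2 + -(a * |z|)) := by
        gcongr A * Real.exp ?_
        nlinarith [sq_nonneg (|z| - (a + 1)), sq_abs z]
    _ = _ := by rw [mul_assoc, ← Real.exp_add]

/-- Weighted exponential off-diagonal decay, uniform in the widths `σ ≤ ρ`. -/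
theorem exists_abs_polyGaussian_mul_exp_le (p : ℝ[X]) (w ρ : ℝ) :
    ∃ A : ℝ, 0 ≤ A ∧ ∀ σ ∈ Ioc 0 ρ, ∀ s v : ℝ,
      |polyGaussian p ((s - v) / σ)| * Real.exp (w * v) ≤
        A * Real.exp (w * s) * Real.exp (-|(s - v) / σ|) := by
  obtain ⟨A, hA, h⟩ := exists_abs_polyGaussian_le_exp p (ρ * |w| + 1)
  refine ⟨A, hA, fun σ hσ s v => ?_⟩
  obtain ⟨z, hz⟩ : ∃ z, z = (s - v) / σ := ⟨_, rfl⟩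
  have hv : v = s - σ * z := by
    rw [hz, mul_div_cancel₀ _ hσ.1.ne']
    ring
  rw [← hz]
  calc |polyGaussian p z| * Real.exp (w * v)
      ≤ A * Real.exp (-((ρ * |w| + 1) * |z|)) * Real.exp (w * v) := by gcongr; exact h z
    _ = A * Real.exp (-((ρ * |w| + 1) * |z|) + w * v) := by rw [mul_assoc, ← Real.exp_add]
    _ ≤ A * Real.exp (w * s + -|z|) := by
        gcongr A * Real.exp ?_
        have h1 : -(w * z) ≤ |w| * |z| := by
          rw [← abs_mul]
          exact neg_le_abs _
        have h2 : σ * -(w * z) ≤ σ * (|w| * |z|) := mul_le_mul_of_nonneg_left h1 hσ.1.le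
        have h3 : σ * (|w| * |z|) ≤ ρ * (|w| * |z|) :=
          mul_le_mul_of_nonneg_right hσ.2 (by positivity)
        rw [hv]
        linarith
    _ = _ := by rw [Real.exp_add, mul_assoc]

theorem integrable_exp_neg_abs : Integrable fun z : ℝ => Real.exp (-|z|) := by
  have h0 := (integrableOn_exp_mul_Iic (a := 1) one_pos 0).congr_fun
    (g := fun z : ℝ => Real.exp (-|z|))
    (fun z hz => by simp [abs_of_nonpos (mem_Iic.1 hz)]) measurableSet_Iic
  have h1 := (integrableOn_exp_mul_Ioi (a := -1) (by norm_num) 0).congr_fun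
    (g := fun z : ℝ => Real.exp (-|z|))
    (fun z hz => by simp [abs_of_pos (mem_Ioi.1 hz)]) measurableSet_Ioi
  have h := h0.union h1
  rwa [Iic_union_Ioi, integrableOn_univ] at h

theorem integrable_exp_neg_abs_sub_div {σ : ℝ} (hσ : 0 < σ) (s : ℝ) :
    Integrable fun v : ℝ => Real.exp (-|(s - v) / σ|) :=
  ((integrable_comp_div_iff (fun z : ℝ => Real.exp (-|z|)) hσ.ne').2
    integrable_exp_neg_abs).comp_sub_left s

theorem integral_exp_neg_abs_sub_div {σ : ℝ} (hσ : 0 < σ) (s : ℝ) :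
    ∫ v : ℝ, Real.exp (-|(s - v) / σ|) = σ * ∫ z : ℝ, Real.exp (-|z|) := by
  rw [integral_sub_left_eq_self (fun v : ℝ => Real.exp (-|v / σ|)) volume s,
    Measure.integral_comp_div (fun z : ℝ => Real.exp (-|z|)), abs_of_pos hσ, smul_eq_mul]

theorem hasDerivAt_gaussianConv {σ w S : ℝ} (hσ : 0 < σ) {φ : ℝ → ℝ} (hφ : Continuous φ)
    (hS : ∀ v, |φ v| ≤ S * Real.exp (w * v)) (p : ℝ[X]) (s : ℝ) :
    HasDerivAt (gaussianConv σ φ p) (σ⁻¹ * gaussianConv σ φ (polyGaussianDeriv p) s) s := by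
  have hS0 : 0 ≤ S := by simpa using (abs_nonneg _).trans (hS 0)
  have hcont : ∀ (q : ℝ[X]) (x : ℝ), Continuous fun v => polyGaussian q ((x - v) / σ) * φ v :=
    fun q x => ((continuous_polyGaussian q).comp (by fun_prop)).mul hφ
  have key : ∀ q : ℝ[X], ∃ A : ℝ, 0 ≤ A ∧ ∀ x v : ℝ, |polyGaussian q ((x - v) / σ) * φ v| ≤
      A * S * Real.exp (w * x) * Real.exp (-|(x - v) / σ|) := by
    intro q
    obtain ⟨A, hA, h⟩ := exists_abs_polyGaussian_mul_exp_le q w σ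
    refine ⟨A, hA, fun x v => ?_⟩
    rw [abs_mul]
    calc |polyGaussian q ((x - v) / σ)| * |φ v|
        ≤ |polyGaussian q ((x - v) / σ)| * (S * Real.exp (w * v)) := by gcongr; exact hS v
      _ = S * (|polyGaussian q ((x - v) / σ)| * Real.exp (w * v)) := by ring
      _ ≤ S * (A * Real.exp (w * x) * Real.exp (-|(x - v) / σ|)) := by
          gcongr S * ?_
          exact h σ ⟨hσ, le_rfl⟩ x v
      _ = _ := by ring
  obtain ⟨A, -, hA⟩ := key p
  obtain ⟨B, hB0, hB⟩ := key (polyGaussianDeriv p)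
  have main := (hasDerivAt_integral_of_dominated_loc_of_deriv_le (μ := volume)
    (F := fun x v => polyGaussian p ((x - v) / σ) * φ v)
    (F' := fun x v => σ⁻¹ * (polyGaussian (polyGaussianDeriv p) ((x - v) / σ) * φ v))
    (bound := fun v => σ⁻¹ * (B * S * Real.exp (w * s + |w|) * Real.exp σ⁻¹) *
      Real.exp (-|(s - v) / σ|))
    (Metric.ball_mem_nhds s one_pos)
    (Eventually.of_forall fun x => (hcont p x).aestronglyMeasurable)
    (((integrable_exp_neg_abs_sub_div hσ s).const_mul _).mono'
      (hcont p s).aestronglyMeasurable (Eventually.of_forall (hA s)))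
    ((hcont _ s).const_mul _).aestronglyMeasurable
    (Eventually.of_forall fun v x hx => ?_)
    ((integrable_exp_neg_abs_sub_div hσ s).const_mul _)
    (Eventually.of_forall fun v x _ => ?_)).2
  · rw [integral_const_mul] at main
    exact main
  · have hxs : |x - s| ≤ 1 := by
      rw [← Real.dist_eq]
      exact (Metric.mem_ball.1 hx).le
    have h1 : w * x ≤ w * s + |w| := by
      have : w * (x - s) ≤ |w| * 1 :=
        (le_abs_self _).trans ((abs_mul _ _).le.trans (by gcongr))
      linarith
    have h2 : -|(x - v) / σ| ≤ σ⁻¹ + -|(s - v) / σ| := by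
      have h3 : |s - v| ≤ 1 + |x - v| := by
        have := abs_sub_le s x v
        rw [abs_sub_comm s x] at this
        linarith
      have h4 : |s - v| * σ⁻¹ ≤ (1 + |x - v|) * σ⁻¹ := by gcongr
      rw [abs_div, abs_div, abs_of_pos hσ, div_eq_mul_inv, div_eq_mul_inv]
      linarith
    rw [Real.norm_eq_abs, abs_mul, abs_of_pos (inv_pos.2 hσ), mul_assoc]
    gcongr
    refine (hB x v).trans ?_
    rw [mul_assoc (B * S * _), ← Real.exp_add σ⁻¹]
    gcongr
  · have h : HasDerivAt (fun x : ℝ => (x - v) / σ) σ⁻¹ x := by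
      simpa using ((hasDerivAt_id x).sub_const v).div_const σ
    refine (((hasDerivAt_polyGaussian p ((x - v) / σ)).comp x h).mul_const (φ v)).congr_deriv ?_
    ring

theorem contDiff_gaussianConv {σ w S : ℝ} (hσ : 0 < σ) {φ : ℝ → ℝ} (hφ : Continuous φ)
    (hS : ∀ v, |φ v| ≤ S * Real.exp (w * v)) (p : ℝ[X]) :
    ContDiff ℝ (⊤ : ℕ∞) (gaussianConv σ φ p) := by
  rw [contDiff_infty]
  intro n
  induction n generalizing p with
  | zero =>
    exact contDiff_zero.2 (continuous_iff_continuousAt.2 fun s =>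
      (hasDerivAt_gaussianConv hσ hφ hS p s).continuousAt)
  | succ n ih =>
    push_cast
    refine contDiff_succ_iff_deriv.2
      ⟨fun s => (hasDerivAt_gaussianConv hσ hφ hS p s).differentiableAt, by simp, ?_⟩
    rw [show deriv (gaussianConv σ φ p) = _ from
      funext fun s => (hasDerivAt_gaussianConv hσ hφ hS p s).deriv]
    exact contDiff_const.mul (ih _)

theorem exists_abs_gaussianConv_le (p : ℝ[X]) (w ρ : ℝ) :
    ∃ A : ℝ, 0 ≤ A ∧ ∀ σ ∈ Ioc 0 ρ, ∀ (φ : ℝ → ℝ) (S : ℝ),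
      (∀ v, |φ v| ≤ S * Real.exp (w * v)) →
      ∀ s, |gaussianConv σ φ p s| ≤ A * σ * S * Real.exp (w * s) := by
  obtain ⟨A, hA, h⟩ := exists_abs_polyGaussian_mul_exp_le p w ρ
  refine ⟨A * ∫ z : ℝ, Real.exp (-|z|),
    mul_nonneg hA (integral_nonneg fun z => (Real.exp_pos _).le), fun σ hσ φ S hS s => ?_⟩
  have hS0 : 0 ≤ S := by simpa using (abs_nonneg _).trans (hS 0)
  have hle : |gaussianConv σ φ p s| ≤
      ∫ v, S * (A * Real.exp (w * s)) * Real.exp (-|(s - v) / σ|) := by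
    rw [gaussianConv, ← Real.norm_eq_abs]
    refine norm_integral_le_of_norm_le
      ((integrable_exp_neg_abs_sub_div hσ.1 s).const_mul _) (Eventually.of_forall fun v => ?_)
    rw [Real.norm_eq_abs, abs_mul]
    calc |polyGaussian p ((s - v) / σ)| * |φ v|
        ≤ |polyGaussian p ((s - v) / σ)| * (S * Real.exp (w * v)) := by gcongr; exact hS v
      _ = S * (|polyGaussian p ((s - v) / σ)| * Real.exp (w * v)) := by ring
      _ ≤ S * (A * Real.exp (w * s) * Real.exp (-|(s - v) / σ|)) := by
          gcongr S * ?_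
          exact h σ hσ s v
      _ = _ := by ring
  rw [integral_const_mul, integral_exp_neg_abs_sub_div hσ.1] at hle
  exact hle.trans_eq (by ring)

/-- In the coordinate `log x` the b-heat operator is convolution with a Gaussian. -/
theorem bHeatOp_eq_gaussianConv_log {t : ℝ} (ht : 0 < t) (f : ℝ → ℝ) {x : ℝ} (hx : 0 < x) :
    bHeatOp t f x = (4 * Real.pi * t) ^ (-(1:ℝ) / 2) *
      gaussianConv (√(2 * t)) (fun v => f (Real.exp v)) 1 (Real.log x) := by
  have h := integral_image_eq_integral_abs_deriv_smul MeasurableSet.univ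
    (fun v _ => (Real.hasDerivAt_exp v).hasDerivWithinAt) Real.exp_injective.injOn
    (fun y => bHeatKernel t x y * f y / y)
  rw [image_univ, Real.range_exp, setIntegral_univ] at h
  rw [bHeatOp, h, gaussianConv, ← integral_const_mul]
  refine integral_congr_ae (Eventually.of_forall fun v => ?_)
  have hexp : -((Real.log x - v) / √(2 * t)) ^ 2 / 2 = -(Real.log x - v) ^ 2 / (4 * t) := by
    rw [div_pow, Real.sq_sqrt (by positivity)]
    field_simp
    norm_num
  simp only [smul_eq_mul, Real.abs_exp, bHeatKernel, polyGaussian, eval_one, one_mul,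
    Real.log_div hx.ne' (Real.exp_pos v).ne', Real.log_exp, hexp]
  field_simp

theorem xDdx_iterate_bHeatOp {t w S : ℝ} (ht : 0 < t) {f : ℝ → ℝ}
    (hf : Continuous fun v => f (Real.exp v))
    (hS : ∀ v, |f (Real.exp v)| ≤ S * Real.exp (w * v)) (n : ℕ) {x : ℝ} (hx : 0 < x) :
    xDdx^[n] (bHeatOp t f) x = (4 * Real.pi * t) ^ (-(1:ℝ) / 2) * (√(2 * t))⁻¹ ^ n *
      gaussianConv (√(2 * t)) (fun v => f (Real.exp v)) (polyGaussianDeriv^[n] 1)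
        (Real.log x) := by
  induction n generalizing x with
  | zero => simpa using bHeatOp_eq_gaussianConv_log ht f hx
  | succ n ih =>
    rw [Function.iterate_succ_apply', Function.iterate_succ_apply', xDdx,
      EventuallyEq.deriv_eq (eventually_of_mem (Ioi_mem_nhds hx) fun y hy => ih hy)]
    have h := ((hasDerivAt_gaussianConv (σ := √(2 * t)) (by positivity) hf hS
      (polyGaussianDeriv^[n] 1) (Real.log x)).comp x (Real.hasDerivAt_log hx.ne')).const_mul
      ((4 * Real.pi * t) ^ (-(1:ℝ) / 2) * (√(2 * t))⁻¹ ^ n)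
    simp only [Function.comp_def] at h
    rw [h.deriv, pow_succ]
    field_simp

theorem rpow_neg_half_mul_sqrt_pow {t : ℝ} (ht : 0 < t) (n : ℕ) :
    (4 * Real.pi * t) ^ (-(1:ℝ) / 2) * (√(2 * t))⁻¹ ^ n * √(2 * t) ≤ t ^ (-(n : ℝ) / 2) := by
  have h1 : (4 * Real.pi * t) ^ (-(1:ℝ) / 2) * √(2 * t) ≤ 1 := by
    rw [neg_div, Real.rpow_neg (by positivity), ← Real.sqrt_eq_rpow, inv_mul_le_one₀
      (by positivity)]
    exact Real.sqrt_le_sqrt (by nlinarith [Real.pi_gt_three])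
  have h2 : (√(2 * t))⁻¹ ^ n ≤ t ^ (-(n : ℝ) / 2) := by
    have h3 : t ^ (-(n : ℝ) / 2) = (√t)⁻¹ ^ n := by
      rw [Real.sqrt_eq_rpow, ← Real.rpow_neg ht.le, ← Real.rpow_mul_natCast ht.le]
      congr 1
      ring
    rw [h3]
    gcongr
    linarith
  calc _ = (4 * Real.pi * t) ^ (-(1:ℝ) / 2) * √(2 * t) * (√(2 * t))⁻¹ ^ n := by ring
    _ ≤ 1 * t ^ (-(n : ℝ) / 2) := by gcongr
    _ = _ := one_mul _

end

/-- **Weighted `C⁰ → Cⁿ` estimate for the b-heat operator.** For every `w ∈ ℝ` and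
`n ∈ ℕ` there is `C > 0` such that for `t ∈ (0,1]` and every continuous
`f : (0,∞) → ℝ` with `sup_{x>0} x^{-w} |f x| < ∞`, `E_t f` is smooth on `(0,∞)` and
`sup_{x>0} x^{-w} |((x d/dx)^n E_t f)(x)| ≤ C t^{-n/2} sup_{x>0} x^{-w} |f x|`. -/
theorem bHeatOp_weighted_Cn (w : ℝ) (n : ℕ) :
    ∃ C : ℝ, 0 < C ∧ ∀ t ∈ Ioc (0:ℝ) 1, ∀ f : ℝ → ℝ,
      ContinuousOn f (Ioi 0) →
      (∃ M : ℝ, ∀ x > (0:ℝ), x ^ (-w) * |f x| ≤ M) →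
      ContDiffOn ℝ (⊤ : ℕ∞) (bHeatOp t f) (Ioi 0) ∧
      ∀ x > (0:ℝ), x ^ (-w) * |xDdx^[n] (bHeatOp t f) x| ≤
        C * t ^ (-(n : ℝ) / 2) * ⨆ p : {x : ℝ // 0 < x}, ((p : ℝ) ^ (-w) * |f p|) := by
  obtain ⟨A, hA0, hA⟩ := exists_abs_gaussianConv_le (polyGaussianDeriv^[n] 1) w (√2)
  refine ⟨A + 1, by positivity, fun t ht f hf ⟨M, hM⟩ => ?_⟩
  set S := ⨆ p : {x : ℝ // 0 < x}, ((p : ℝ) ^ (-w) * |f p|) with hSdef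
  have hφ : Continuous fun v => f (Real.exp v) :=
    hf.comp_continuous Real.continuous_exp fun v => Real.exp_pos v
  have hS : ∀ v, |f (Real.exp v)| ≤ S * Real.exp (w * v) := by
    intro v
    have hbdd : BddAbove (range fun p : {x : ℝ // 0 < x} => (p : ℝ) ^ (-w) * |f p|) :=
      ⟨M, by rintro _ ⟨p, rfl⟩; exact hM p p.2⟩
    have h := le_ciSup hbdd ⟨Real.exp v, Real.exp_pos v⟩
    simp only [← Real.exp_mul, ← hSdef] at h
    rwa [mul_neg, Real.exp_neg, inv_mul_le_iff₀ (Real.exp_pos _), mul_comm v, mul_comm] at h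
  have hS0 : 0 ≤ S := by simpa using (abs_nonneg _).trans (hS 0)
  have hσ : 0 < √(2 * t) := Real.sqrt_pos.2 (mul_pos two_pos ht.1)
  refine ⟨?_, fun x hx => ?_⟩
  · refine (contDiffOn_const.mul ((contDiff_gaussianConv hσ hφ hS 1).comp_contDiffOn
      (Real.contDiffOn_log.mono fun x hx => (mem_Ioi.1 hx).ne'))).congr
      fun x hx => bHeatOp_eq_gaussianConv_log ht.1 f hx
  · rw [xDdx_iterate_bHeatOp ht.1 hφ hS n hx]
    have ht0 := ht.1
    have hc : 0 ≤ (4 * Real.pi * t) ^ (-(1:ℝ) / 2) * (√(2 * t))⁻¹ ^ n := by positivity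
    have hσ2 : √(2 * t) ≤ √2 := Real.sqrt_le_sqrt (by linarith [ht.2])
    have hxw : Real.exp (w * Real.log x) = x ^ w := by
      rw [Real.rpow_def_of_pos hx, mul_comm]
    rw [abs_mul, abs_of_nonneg hc]
    have hG := hA _ ⟨hσ, hσ2⟩ _ S hS (Real.log x)
    rw [hxw] at hG
    have hxx : x ^ (-w) * x ^ w = 1 := by
      rw [← Real.rpow_add hx, neg_add_cancel, Real.rpow_zero]
    calc _ ≤ x ^ (-w) * ((4 * Real.pi * t) ^ (-(1:ℝ) / 2) * (√(2 * t))⁻¹ ^ n *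
          (A * √(2 * t) * S * x ^ w)) := by gcongr
      _ = x ^ (-w) * x ^ w * ((4 * Real.pi * t) ^ (-(1:ℝ) / 2) * (√(2 * t))⁻¹ ^ n *
          √(2 * t)) * A * S := by ring
      _ ≤ 1 * t ^ (-(n : ℝ) / 2) * (A + 1) * S := by
          rw [hxx]
          gcongr
          · exact rpow_neg_half_mul_sqrt_pow ht0 n
          · linarith
      _ = _ := by ring
end

section
/- For every w ∈ ℝ and every α ∈ (0,1) there is a constant C > 0 such that the following holds for all t ∈ (0,1]: if f : (0,∞) → ℝ is such that g(x) := x^{-w} f(x) is bounded and satisfies |g(x) − g(x̃)| ≤ K |log(x/x̃)|^α for all x, x̃ > 0, then E_t f is smooth on (0,∞) and sup_{x>0} x^{-w} ( |E_t f(x)| + |x (E_t f)'(x)| + |((x·d/dx)² E_t f)(x)| ) ≤ C t^{-1+α/2} ( sup_{x>0} |g(x)| + K ). -/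
open MeasureTheory Set

open Polynomial in
/-- The operator `D` on polynomials with `(p e^{-v²/(4t)})' = (D p) e^{-v²/(4t)}`. -/
noncomputable def gaussDeriv (t : ℝ) (p : ℝ[X]) : ℝ[X] :=
  derivative p - C (1 / (2 * t)) * X * p

open Polynomial in
/-- Convolution of `φ` with the kernel `p(v) e^{-v²/(4t)}`. -/
noncomputable def gaussConv (t : ℝ) (p : ℝ[X]) (φ : ℝ → ℝ) (s : ℝ) : ℝ :=
  ∫ u, p.eval (s - u) * Real.exp (-(s - u) ^ 2 / (4 * t)) * φ u

theorem Polynomial.exists_abs_eval_le_exp (p : Polynomial ℝ) :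
    ∃ C, 0 ≤ C ∧ ∀ x, |p.eval x| ≤ C * Real.exp |x| := by
  induction p using Polynomial.induction_on' with
  | add p q hp hq =>
    obtain ⟨A, hA, hp⟩ := hp
    obtain ⟨B, hB, hq⟩ := hq
    refine ⟨A + B, by positivity, fun x => ?_⟩
    rw [Polynomial.eval_add, add_mul]
    exact (abs_add_le _ _).trans (add_le_add (hp x) (hq x))
  | monomial n a =>
    refine ⟨|a| * n.factorial, by positivity, fun x => ?_⟩
    rw [Polynomial.eval_monomial, abs_mul, abs_pow, mul_assoc]
    gcongr
    have h := Real.pow_div_factorial_le_exp |x| (abs_nonneg x) n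
    rwa [div_le_iff₀' (by positivity)] at h

/-- A Gaussian bound, uniform for `s` in bounded sets, for the integrand of `gaussConv`. -/
theorem exists_gaussConv_integrand_bound {t : ℝ} (ht : 0 < t) (p : Polynomial ℝ) (w R : ℝ) :
    ∃ C, 0 ≤ C ∧ ∀ s u, |s| ≤ R →
      |p.eval (s - u) * Real.exp (-(s - u) ^ 2 / (4 * t))| * Real.exp (w * u) ≤
        C * Real.exp (-(1 / (16 * t)) * u ^ 2) := by
  obtain ⟨C, hC, hp⟩ := p.exists_abs_eval_le_exp
  refine ⟨C * Real.exp (R + R ^ 2 / (4 * t) + 4 * t * (1 + |w|) ^ 2), by positivity,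
    fun s u hs => ?_⟩
  rw [abs_mul, Real.abs_exp]
  calc _ ≤ C * Real.exp |s - u| * Real.exp (-(s - u) ^ 2 / (4 * t)) * Real.exp (w * u) := by
        gcongr
        exact hp _
    _ = C * Real.exp (|s - u| + -(s - u) ^ 2 / (4 * t) + w * u) := by
        rw [Real.exp_add, Real.exp_add]; ring
    _ ≤ C * Real.exp (R + R ^ 2 / (4 * t) + 4 * t * (1 + |w|) ^ 2 +
          -(1 / (16 * t)) * u ^ 2) := by
        refine mul_le_mul_of_nonneg_left (Real.exp_le_exp.2 ?_) hC
        have h1 : |s - u| ≤ R + |u| := (abs_sub _ _).trans (by linarith)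
        have h2 : w * u ≤ |w| * |u| := by rw [← abs_mul]; exact le_abs_self _
        have hs2 : s ^ 2 ≤ R ^ 2 := sq_le_sq' (abs_le.1 hs).1 (abs_le.1 hs).2
        have h3 : -(s - u) ^ 2 / (4 * t) ≤ R ^ 2 / (4 * t) - u ^ 2 / (8 * t) := by
          have : R ^ 2 / (4 * t) - u ^ 2 / (8 * t) = (R ^ 2 - u ^ 2 / 2) / (4 * t) := by
            field_simp; ring
          rw [this]
          gcongr
          nlinarith [sq_nonneg (2 * s - u)]
        have h4 : (1 + |w|) * |u| ≤ 4 * t * (1 + |w|) ^ 2 + u ^ 2 / (16 * t) := by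
          have : 4 * t * (1 + |w|) ^ 2 + u ^ 2 / (16 * t) - (1 + |w|) * |u| =
              (8 * t * (1 + |w|) - |u|) ^ 2 / (16 * t) := by
            rw [← sq_abs u]; field_simp; ring
          have h0 : 0 ≤ (8 * t * (1 + |w|) - |u|) ^ 2 / (16 * t) := by positivity
          linarith
        have h5 : u ^ 2 / (8 * t) = u ^ 2 / (16 * t) + 1 / (16 * t) * u ^ 2 := by
          field_simp; ring
        linarith
    _ = _ := by rw [Real.exp_add]; ring

theorem integrable_gaussConv_dominator {t : ℝ} (ht : 0 < t) (C : ℝ) :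
    Integrable fun u : ℝ => C * Real.exp (-(1 / (16 * t)) * u ^ 2) :=
  (integrable_exp_neg_mul_sq (by positivity)).const_mul C

theorem aestronglyMeasurable_gaussConv_integrand (t : ℝ) (p : Polynomial ℝ) {φ : ℝ → ℝ}
    (hφ : AEStronglyMeasurable φ) (s : ℝ) :
    AEStronglyMeasurable
      fun u => p.eval (s - u) * Real.exp (-(s - u) ^ 2 / (4 * t)) * φ u := by
  refine AEStronglyMeasurable.mul (Continuous.aestronglyMeasurable ?_) hφ
  exact (p.continuous.comp (by fun_prop)).mul (by fun_prop)

theorem exists_abs_gaussConv_integrand_le {t : ℝ} (ht : 0 < t) (p : Polynomial ℝ) {φ : ℝ → ℝ}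
    {w M : ℝ} (hM : ∀ u, |φ u| ≤ M * Real.exp (w * u)) (R : ℝ) :
    ∃ C, ∀ s u, |s| ≤ R →
      ‖p.eval (s - u) * Real.exp (-(s - u) ^ 2 / (4 * t)) * φ u‖ ≤
        C * Real.exp (-(1 / (16 * t)) * u ^ 2) := by
  have hM0 : 0 ≤ M := by simpa using (abs_nonneg _).trans (hM 0)
  obtain ⟨C, -, h⟩ := exists_gaussConv_integrand_bound ht p w R
  refine ⟨M * C, fun s u hs => ?_⟩
  rw [Real.norm_eq_abs, abs_mul]
  calc _ ≤ |p.eval (s - u) * Real.exp (-(s - u) ^ 2 / (4 * t))| * (M * Real.exp (w * u)) := by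
        gcongr; exact hM u
    _ = M * (|p.eval (s - u) * Real.exp (-(s - u) ^ 2 / (4 * t))| * Real.exp (w * u)) := by ring
    _ ≤ M * (C * Real.exp (-(1 / (16 * t)) * u ^ 2)) := mul_le_mul_of_nonneg_left (h s u hs) hM0
    _ = _ := by ring

theorem integrable_gaussConv_integrand {t : ℝ} (ht : 0 < t) (p : Polynomial ℝ) {φ : ℝ → ℝ}
    (hφ : AEStronglyMeasurable φ) {w M : ℝ} (hM : ∀ u, |φ u| ≤ M * Real.exp (w * u)) (s : ℝ) :
    Integrable fun u => p.eval (s - u) * Real.exp (-(s - u) ^ 2 / (4 * t)) * φ u := by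
  obtain ⟨C, h⟩ := exists_abs_gaussConv_integrand_le ht p hM |s|
  exact (integrable_gaussConv_dominator ht C).mono'
    (aestronglyMeasurable_gaussConv_integrand t p hφ s) (ae_of_all _ fun u => h s u le_rfl)

theorem hasDerivAt_gaussConv {t : ℝ} (ht : 0 < t) (p : Polynomial ℝ) {φ : ℝ → ℝ}
    (hφ : AEStronglyMeasurable φ) {w M : ℝ} (hM : ∀ u, |φ u| ≤ M * Real.exp (w * u)) (s : ℝ) :
    HasDerivAt (gaussConv t p φ) (gaussConv t (gaussDeriv t p) φ s) s := by
  obtain ⟨C, h⟩ := exists_abs_gaussConv_integrand_le ht (gaussDeriv t p) hM (|s| + 1)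
  refine (hasDerivAt_integral_of_dominated_loc_of_deriv_le (Metric.ball_mem_nhds s one_pos)
    (.of_forall fun x => aestronglyMeasurable_gaussConv_integrand t p hφ x)
    (integrable_gaussConv_integrand ht p hφ hM s)
    (aestronglyMeasurable_gaussConv_integrand t (gaussDeriv t p) hφ s)
    (ae_of_all _ fun u x hx => h x u ?_) (integrable_gaussConv_dominator ht C)
    (ae_of_all _ fun u x _ => ?_)).2
  · have := abs_sub_abs_le_abs_sub x s
    rw [Metric.mem_ball, Real.dist_eq] at hx
    linarith
  · have hv : HasDerivAt (fun x : ℝ => x - u) 1 x := (hasDerivAt_id x).sub_const u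
    have hp : HasDerivAt (fun x => p.eval (x - u)) (p.derivative.eval (x - u) * 1) x := by
      have := HasDerivAt.comp x (p.hasDerivAt (x - u)) hv
      exact this
    have he := ((hv.pow 2).neg.div_const (4 * t)).exp
    refine ((hp.mul he).mul_const (φ u)).congr_deriv ?_
    simp only [gaussDeriv, Polynomial.eval_sub, Polynomial.eval_mul, Polynomial.eval_C,
      Polynomial.eval_X, Pi.pow_apply, Pi.neg_apply]
    field_simp
    push_cast
    ring

theorem contDiff_gaussConv {t : ℝ} (ht : 0 < t) (p : Polynomial ℝ) {φ : ℝ → ℝ}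
    (hφ : AEStronglyMeasurable φ) {w M : ℝ} (hM : ∀ u, |φ u| ≤ M * Real.exp (w * u)) :
    ContDiff ℝ (⊤ : ℕ∞) (gaussConv t p φ) := by
  refine contDiff_infty.2 fun n => ?_
  induction n generalizing p with
  | zero =>
    exact contDiff_zero.2 (continuous_iff_continuousAt.2 fun s =>
      (hasDerivAt_gaussConv ht p hφ hM s).continuousAt)
  | succ n ih =>
    have hd := hasDerivAt_gaussConv ht p hφ hM
    rw [Nat.cast_succ, contDiff_succ_iff_deriv]
    refine ⟨fun s => (hd s).differentiableAt, by simp, ?_⟩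
    rw [funext fun s => (hd s).deriv]
    exact ih _

theorem gaussConv_exp (t : ℝ) (p : Polynomial ℝ) (w s : ℝ) :
    gaussConv t p (fun u => Real.exp (w * u)) s =
      Real.exp (w * s) * gaussConv t p (fun u => Real.exp (w * u)) 0 := by
  unfold gaussConv
  rw [← integral_const_mul, ← integral_add_right_eq_self _ s]
  refine integral_congr_ae (ae_of_all _ fun u => ?_)
  simp only [mul_add, Real.exp_add, zero_sub, sub_add_cancel_right]
  ring

theorem gaussConv_gaussDeriv_exp {t : ℝ} (ht : 0 < t) (p : Polynomial ℝ) (w s : ℝ) :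
    gaussConv t (gaussDeriv t p) (fun u => Real.exp (w * u)) s =
      w * gaussConv t p (fun u => Real.exp (w * u)) s := by
  have h := hasDerivAt_gaussConv ht p (φ := fun u => Real.exp (w * u)) (w := w) (M := 1)
    (Continuous.aestronglyMeasurable (by fun_prop)) (by simp) s
  rw [funext (gaussConv_exp t p w)] at h
  have h' := (((hasDerivAt_id s).const_mul w).exp.mul_const
    (gaussConv t p (fun u => Real.exp (w * u)) 0))
  rw [h.unique h', gaussConv_exp t p w s]
  simp only [id]
  ring

theorem exists_gauss_absorb (w : ℝ) :
    ∃ C : ℝ, 0 < C ∧ ∀ r ≥ (0 : ℝ), ∀ β ∈ Icc (0 : ℝ) 1,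
      (1 + r ^ 2) * r ^ β * Real.exp (|w| * r) * Real.exp (-r ^ 2 / 4) ≤
        C * Real.exp (-r ^ 2 / 8) := by
  refine ⟨2 * Real.exp (2 * (|w| + 2) ^ 2), by positivity, fun r hr β hβ => ?_⟩
  have h1 : 1 + r ^ 2 ≤ 2 * Real.exp r := by
    have := Real.quadratic_le_exp_of_nonneg hr
    linarith
  have h2 : r ^ β ≤ Real.exp r := by
    refine le_trans ?_ (Real.add_one_le_exp r)
    rcases le_total r 1 with h | h
    · have := Real.rpow_le_one hr h hβ.1
      linarith
    · have := Real.rpow_le_rpow_of_exponent_le h hβ.2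
      rw [Real.rpow_one] at this
      linarith
  calc _ ≤ 2 * Real.exp r * Real.exp r * Real.exp (|w| * r) * Real.exp (-r ^ 2 / 4) := by
        gcongr
    _ = 2 * Real.exp (r + r + |w| * r + -r ^ 2 / 4) := by
        simp only [Real.exp_add]; ring
    _ ≤ 2 * Real.exp (2 * (|w| + 2) ^ 2 + -r ^ 2 / 8) := by
        refine mul_le_mul_of_nonneg_left (Real.exp_le_exp.2 ?_) two_pos.le
        nlinarith [sq_nonneg (r - 4 * (|w| + 2))]
    _ = _ := by rw [Real.exp_add]; ring

theorem integral_exp_neg_sub_sq_div {t : ℝ} (ht : 0 < t) (s : ℝ) :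
    Integrable (fun u : ℝ => Real.exp (-(s - u) ^ 2 / (8 * t))) ∧
      (4 * Real.pi * t) ^ (-(1:ℝ) / 2) * ∫ u : ℝ, Real.exp (-(s - u) ^ 2 / (8 * t)) = √2 := by
  have he : ∀ v : ℝ, Real.exp (-v ^ 2 / (8 * t)) = Real.exp (-(1 / (8 * t)) * v ^ 2) :=
    fun v => by congr 1; field_simp
  constructor
  · simp_rw [he]
    exact (integrable_exp_neg_mul_sq (by positivity)).comp_sub_left s
  · rw [integral_sub_left_eq_self (fun v : ℝ => Real.exp (-v ^ 2 / (8 * t)))]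
    simp_rw [he]
    rw [integral_gaussian, neg_div, Real.rpow_neg (by positivity), ← Real.sqrt_eq_rpow,
      ← Real.sqrt_inv, ← Real.sqrt_mul (by positivity)]
    congr 1
    field_simp
    norm_num

/-- Scale-invariant bound for `gaussConv` on functions vanishing to order `β` at `s`. -/
theorem exists_gaussConv_bound (w : ℝ) :
    ∃ C : ℝ, 0 < C ∧ ∀ t ∈ Ioc (0 : ℝ) 1, ∀ β ∈ Icc (0 : ℝ) 1, ∀ (m A s : ℝ) (p : Polynomial ℝ)
      (φ : ℝ → ℝ), 0 ≤ A → (∀ v, |p.eval v| ≤ t ^ (-m) * (1 + v ^ 2 / t)) →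
      (∀ u, |φ u| ≤ A * |s - u| ^ β * Real.exp (w * u)) →
      (4 * Real.pi * t) ^ (-(1:ℝ) / 2) * |gaussConv t p φ s| ≤
        C * A * t ^ (-m + β / 2) * Real.exp (w * s) := by
  obtain ⟨C, hC, habs⟩ := exists_gauss_absorb w
  refine ⟨√2 * C, by positivity, fun t ⟨ht, ht1⟩ β hβ m A s p φ hA hp hφ => ?_⟩
  obtain ⟨hint, hval⟩ := integral_exp_neg_sub_sq_div ht s
  have hst : 0 < √t := Real.sqrt_pos.2 ht
  have key : ∀ u, ‖p.eval (s - u) * Real.exp (-(s - u) ^ 2 / (4 * t)) * φ u‖ ≤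
      C * A * t ^ (-m + β / 2) * Real.exp (w * s) * Real.exp (-(s - u) ^ 2 / (8 * t)) := by
    intro u
    set r := |s - u| / √t with hr
    have hr0 : 0 ≤ r := by positivity
    have hrt : |s - u| = r * √t := by rw [hr]; field_simp
    have hrt2 : (s - u) ^ 2 = r ^ 2 * t := by rw [← sq_abs, hrt, mul_pow, Real.sq_sqrt ht.le]
    have hrβ : |s - u| ^ β = r ^ β * t ^ (β / 2) := by
      rw [hrt, Real.mul_rpow hr0 hst.le, Real.sqrt_eq_rpow, ← Real.rpow_mul ht.le]
      ring_nf
    have hp' : |p.eval (s - u)| ≤ t ^ (-m) * (1 + r ^ 2) := by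
      have := hp (s - u)
      rwa [hrt2, mul_div_cancel_right₀ _ ht.ne'] at this
    have hw : Real.exp (w * u) ≤ Real.exp (w * s) * Real.exp (|w| * r) := by
      rw [← Real.exp_add]
      refine Real.exp_le_exp.2 ?_
      have h1 : -w * (s - u) ≤ |w| * |s - u| := by
        rw [← abs_neg w, ← abs_mul]; exact le_abs_self _
      have h2 : |s - u| ≤ r := by
        rw [hrt]; exact mul_le_of_le_one_right hr0 (Real.sqrt_le_one.2 ht1)
      have h3 := mul_le_mul_of_nonneg_left h2 (abs_nonneg w)
      linarith
    have h4 : -(s - u) ^ 2 / (4 * t) = -r ^ 2 / 4 := by rw [hrt2]; field_simp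
    have h8 : -(s - u) ^ 2 / (8 * t) = -r ^ 2 / 8 := by rw [hrt2]; field_simp
    have hφ' : |φ u| ≤
        A * (r ^ β * t ^ (β / 2)) * (Real.exp (w * s) * Real.exp (|w| * r)) := by
      rw [← hrβ]
      exact (hφ u).trans (mul_le_mul_of_nonneg_left hw (by positivity))
    rw [Real.norm_eq_abs, abs_mul, abs_mul, Real.abs_exp, h4, h8, Real.rpow_add ht]
    calc _ ≤ t ^ (-m) * (1 + r ^ 2) * Real.exp (-r ^ 2 / 4) *
          (A * (r ^ β * t ^ (β / 2)) * (Real.exp (w * s) * Real.exp (|w| * r))) := by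
          gcongr
      _ = A * (t ^ (-m) * t ^ (β / 2)) * Real.exp (w * s) *
          ((1 + r ^ 2) * r ^ β * Real.exp (|w| * r) * Real.exp (-r ^ 2 / 4)) := by ring
      _ ≤ A * (t ^ (-m) * t ^ (β / 2)) * Real.exp (w * s) * (C * Real.exp (-r ^ 2 / 8)) :=
          mul_le_mul_of_nonneg_left (habs r hr0 β hβ) (by positivity)
      _ = _ := by ring
  have h := norm_integral_le_of_norm_le (hint.const_mul _) (ae_of_all _ key)
  rw [integral_const_mul, Real.norm_eq_abs] at h
  calc _ ≤ (4 * Real.pi * t) ^ (-(1:ℝ) / 2) * (C * A * t ^ (-m + β / 2) * Real.exp (w * s) *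
        ∫ u : ℝ, Real.exp (-(s - u) ^ 2 / (8 * t))) := by
        gcongr; exact h
    _ = ((4 * Real.pi * t) ^ (-(1:ℝ) / 2) * ∫ u : ℝ, Real.exp (-(s - u) ^ 2 / (8 * t))) *
        (C * A * t ^ (-m + β / 2) * Real.exp (w * s)) := by ring
    _ = _ := by rw [hval]; ring

theorem bHeatOp_eq_gaussConv (t : ℝ) (f : ℝ → ℝ) {x : ℝ} (hx : 0 < x) :
    bHeatOp t f x = (4 * Real.pi * t) ^ (-(1:ℝ) / 2) *
      gaussConv t 1 (fun u => f (Real.exp u)) (Real.log x) := by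
  unfold bHeatOp gaussConv
  rw [← Real.range_exp, ← image_univ, integral_image_eq_integral_abs_deriv_smul MeasurableSet.univ
    (fun u _ => (Real.hasDerivAt_exp u).hasDerivWithinAt) Real.exp_injective.injOn,
    setIntegral_univ, ← integral_const_mul]
  refine integral_congr_ae (ae_of_all _ fun u => ?_)
  simp only [bHeatKernel, Real.log_div hx.ne' (Real.exp_pos u).ne', Real.log_exp, Real.abs_exp,
    smul_eq_mul, Polynomial.eval_one]
  field_simp

theorem xDdx_eq_gaussConv {t : ℝ} (ht : 0 < t) (p : Polynomial ℝ) {φ : ℝ → ℝ}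
    (hφ : AEStronglyMeasurable φ) {w M : ℝ} (hM : ∀ u, |φ u| ≤ M * Real.exp (w * u))
    {h : ℝ → ℝ} {N : ℝ} (hh : ∀ x > (0 : ℝ), h x = N * gaussConv t p φ (Real.log x))
    {x : ℝ} (hx : 0 < x) :
    xDdx h x = N * gaussConv t (gaussDeriv t p) φ (Real.log x) := by
  have hd := ((hasDerivAt_gaussConv ht p hφ hM (Real.log x)).comp x
    (Real.hasDerivAt_log hx.ne')).const_mul N
  have he : h =ᶠ[nhds x] fun y => N * (gaussConv t p φ ∘ Real.log) y := by
    filter_upwards [lt_mem_nhds hx] with y hy using hh y hy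
  rw [xDdx, (hd.congr_of_eventuallyEq he).deriv]
  field_simp

theorem gaussDeriv_one (t : ℝ) : gaussDeriv t 1 = -(Polynomial.C (1 / (2 * t)) * Polynomial.X) := by
  simp [gaussDeriv]

theorem abs_eval_gaussDeriv_one_le {t : ℝ} (ht : 0 < t) (v : ℝ) :
    |(gaussDeriv t 1).eval v| ≤ t ^ (-(1 / 2) : ℝ) * (1 + v ^ 2 / t) := by
  have hst : 0 < √t := Real.sqrt_pos.2 ht
  have ht2 : t = √t ^ 2 := (Real.sq_sqrt ht.le).symm
  rw [Real.rpow_neg ht.le, ← Real.sqrt_eq_rpow, gaussDeriv_one, Polynomial.eval_neg, abs_neg,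
    Polynomial.eval_mul, Polynomial.eval_C, Polynomial.eval_X, abs_mul,
    abs_of_pos (by positivity : 0 < 1 / (2 * t))]
  calc 1 / (2 * t) * |v| = (√t)⁻¹ * (|v| / √t / 2) := by
        nth_rewrite 1 [ht2]; field_simp
    _ ≤ (√t)⁻¹ * (1 + (|v| / √t) ^ 2) := by
        gcongr
        nlinarith [sq_nonneg (|v| / √t - 1), sq_nonneg (|v| / √t)]
    _ = _ := by rw [div_pow, sq_abs, ← ht2]

theorem abs_eval_gaussDeriv_gaussDeriv_one_le {t : ℝ} (ht : 0 < t) (v : ℝ) :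
    |(gaussDeriv t (gaussDeriv t 1)).eval v| ≤ t ^ (-1 : ℝ) * (1 + v ^ 2 / t) := by
  have h : (gaussDeriv t (gaussDeriv t 1)).eval v = t⁻¹ * (v ^ 2 / t / 4 - 1 / 2) := by
    rw [gaussDeriv_one]
    simp only [gaussDeriv, Polynomial.derivative_neg, Polynomial.derivative_C_mul,
      Polynomial.derivative_X, Polynomial.eval_sub, Polynomial.eval_mul, Polynomial.eval_neg,
      Polynomial.eval_C, Polynomial.eval_X, Polynomial.eval_one]
    field_simp
    ring
  have h0 : 0 ≤ v ^ 2 / t := by positivity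
  rw [h, Real.rpow_neg_one, abs_mul, abs_of_pos (inv_pos.2 ht)]
  gcongr
  rw [abs_le]
  constructor <;> linarith

theorem gaussConv_eq_add_sub {t : ℝ} (ht : 0 < t) (p : Polynomial ℝ) {φ : ℝ → ℝ}
    (hφ : AEStronglyMeasurable φ) {w M : ℝ} (hM : ∀ u, |φ u| ≤ M * Real.exp (w * u)) (a s : ℝ) :
    gaussConv t p φ s = a * gaussConv t p (fun u => Real.exp (w * u)) s +
      gaussConv t p (fun u => φ u - a * Real.exp (w * u)) s := by
  have h1 := integrable_gaussConv_integrand ht p hφ hM s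
  have h2 := (integrable_gaussConv_integrand ht p (φ := fun u => Real.exp (w * u)) (w := w)
    (M := 1) (Continuous.aestronglyMeasurable (by fun_prop)) (by simp) s).const_mul a
  unfold gaussConv
  rw [← sub_eq_iff_eq_add', ← integral_const_mul, ← integral_sub h1 h2]
  refine integral_congr_ae (ae_of_all _ fun u => ?_)
  ring

theorem continuous_of_abs_sub_le_rpow_s11 {G : ℝ → ℝ} {K α : ℝ} (hα : 0 < α)
    (h : ∀ u v, |G u - G v| ≤ K * |u - v| ^ α) : Continuous G := by
  refine continuous_iff_continuousAt.2 fun v => tendsto_iff_dist_tendsto_zero.2 ?_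
  refine squeeze_zero (fun _ => dist_nonneg) (fun u => h u v) ?_
  have hc : Continuous fun u : ℝ => K * |u - v| ^ α :=
    continuous_const.mul ((by fun_prop : Continuous fun u : ℝ => |u - v|).rpow_const
      fun _ => Or.inr hα.le)
  simpa [Real.zero_rpow hα.ne'] using hc.tendsto v

/-- **Weighted Hölder `C^α → C²` estimate for the b-heat operator.** For `w ∈ ℝ`,
`α ∈ (0,1)` there is `C > 0` such that for `t ∈ (0,1]`: if `g(x) = x^{-w} f(x)` is
bounded and `α`-Hölder with constant `K` for the b-distance `|log(x/x̃)|`, then `E_t f`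
is smooth on `(0,∞)` and
`sup_{x>0} x^{-w} (|E_t f| + |x (E_t f)'| + |(x d/dx)² E_t f|) ≤
  C t^{-1+α/2} (sup_{x>0} |g| + K)`. -/
theorem bHeatOp_weighted_holder_C2 (w α : ℝ) (hα : α ∈ Ioo (0:ℝ) 1) :
    ∃ C : ℝ, 0 < C ∧ ∀ t ∈ Ioc (0:ℝ) 1, ∀ f : ℝ → ℝ, ∀ K : ℝ,
      (∃ M : ℝ, ∀ x > (0:ℝ), |x ^ (-w) * f x| ≤ M) →
      (∀ x > (0:ℝ), ∀ y > (0:ℝ),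
        |x ^ (-w) * f x - y ^ (-w) * f y| ≤ K * |Real.log (x / y)| ^ α) →
      ContDiffOn ℝ (⊤ : ℕ∞) (bHeatOp t f) (Ioi 0) ∧
      ∀ x > (0:ℝ),
        x ^ (-w) * (|bHeatOp t f x| + |x * deriv (bHeatOp t f) x| +
          |xDdx^[2] (bHeatOp t f) x|) ≤
        C * t ^ (-1 + α / 2) *
          ((⨆ p : {x : ℝ // 0 < x}, |(p : ℝ) ^ (-w) * f p|) + K) := by
  obtain ⟨hα0, hα1⟩ := hα
  obtain ⟨C, hC, hbound⟩ := exists_gaussConv_bound w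
  refine ⟨C * (3 + w ^ 2), by positivity, fun t ⟨ht, ht1⟩ f K hbdd hhol => ?_⟩
  set S := ⨆ p : {x : ℝ // 0 < x}, |(p : ℝ) ^ (-w) * f p| with hS
  have hle : ∀ x > (0 : ℝ), |x ^ (-w) * f x| ≤ S := by
    intro x hx
    obtain ⟨M, hM⟩ := hbdd
    exact le_ciSup (f := fun p : {x : ℝ // 0 < x} => |(p : ℝ) ^ (-w) * f p|)
      ⟨M, by rintro _ ⟨p, rfl⟩; exact hM p p.2⟩ ⟨x, hx⟩
  have hS0 : 0 ≤ S := (abs_nonneg _).trans (hle 1 one_pos)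
  have hK0 : 0 ≤ K := by
    have h := (abs_nonneg _).trans (hhol (Real.exp 1) (Real.exp_pos 1) 1 one_pos)
    simpa using h
  set φ : ℝ → ℝ := fun u => f (Real.exp u) with hφ
  set G : ℝ → ℝ := fun u => Real.exp u ^ (-w) * f (Real.exp u) with hG
  have hφG : ∀ u, φ u = G u * Real.exp (w * u) := by
    intro u
    simp only [hφ, hG]
    rw [mul_right_comm, ← Real.exp_mul, ← Real.exp_add]
    ring_nf
    simp
  have hGS : ∀ u, |G u| ≤ S := fun u => hle _ (Real.exp_pos u)
  have hGK : ∀ u v, |G u - G v| ≤ K * |u - v| ^ α := by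
    intro u v
    have h := hhol _ (Real.exp_pos u) _ (Real.exp_pos v)
    rwa [← Real.exp_sub, Real.log_exp] at h
  have hmeas : AEStronglyMeasurable φ := by
    rw [funext hφG]
    exact ((continuous_of_abs_sub_le_rpow_s11 hα0 hGK).mul (by fun_prop)).aestronglyMeasurable
  have hM : ∀ u, |φ u| ≤ S * Real.exp (w * u) := by
    intro u
    rw [hφG, abs_mul, Real.abs_exp]
    exact mul_le_mul_of_nonneg_right (hGS u) (Real.exp_pos _).le
  set N := (4 * Real.pi * t) ^ (-(1:ℝ) / 2) with hN
  have hN0 : 0 ≤ N := by positivity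
  have hE0 : ∀ x > (0 : ℝ), bHeatOp t f x = N * gaussConv t 1 φ (Real.log x) :=
    fun x hx => bHeatOp_eq_gaussConv t f hx
  have hE1 : ∀ x > (0 : ℝ), xDdx (bHeatOp t f) x = _ :=
    fun x hx => xDdx_eq_gaussConv ht 1 hmeas hM hE0 hx
  have hE2 : ∀ x > (0 : ℝ), xDdx (xDdx (bHeatOp t f)) x = _ :=
    fun x hx => xDdx_eq_gaussConv ht _ hmeas hM hE1 hx
  refine ⟨?_, fun x hx => ?_⟩
  · refine ContDiffOn.congr (f := fun x => N * gaussConv t 1 φ (Real.log x)) ?_ hE0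
    exact contDiffOn_const.mul ((contDiff_gaussConv ht 1 hmeas hM).comp_contDiffOn
      (Real.contDiffOn_log.mono fun y hy => (mem_Ioi.1 hy).ne'))
  set s := Real.log x with hs
  set T := t ^ (-1 + α / 2) with hT
  have hT1 : 1 ≤ T := Real.one_le_rpow_of_pos_of_le_one_of_nonpos ht ht1 (by linarith)
  have h0mem : (0 : ℝ) ∈ Icc (0 : ℝ) 1 := ⟨le_rfl, zero_le_one⟩
  have hone : ∀ v : ℝ, |(1 : Polynomial ℝ).eval v| ≤ t ^ (-0 : ℝ) * (1 + v ^ 2 / t) := by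
    intro v
    have : 0 ≤ v ^ 2 / t := by positivity
    simpa using this
  have hM' : ∀ u, |φ u| ≤ S * |s - u| ^ (0 : ℝ) * Real.exp (w * u) := by simpa using hM
  have b0 := hbound t ⟨ht, ht1⟩ 0 h0mem 0 S s 1 φ hS0 hone hM'
  have b1 := hbound t ⟨ht, ht1⟩ 0 h0mem (1 / 2) S s _ φ hS0 (abs_eval_gaussDeriv_one_le ht) hM'
  have be := hbound t ⟨ht, ht1⟩ 0 h0mem 0 1 s 1 (fun u => Real.exp (w * u)) zero_le_one hone
    (by simp)
  have b2 := hbound t ⟨ht, ht1⟩ α ⟨hα0.le, hα1.le⟩ 1 K s _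
    (fun u => φ u - G s * Real.exp (w * u)) hK0 (abs_eval_gaussDeriv_gaussDeriv_one_le ht) (by
      intro u
      rw [hφG, ← sub_mul, abs_mul, Real.abs_exp, abs_sub_comm]
      exact mul_le_mul_of_nonneg_right (hGK s u) (Real.exp_pos _).le)
  rw [show (-0 + 0 / 2 : ℝ) = 0 by norm_num, Real.rpow_zero, mul_one] at b0 be
  have hT2 : t ^ (-(1 / 2) + 0 / 2 : ℝ) ≤ T :=
    Real.rpow_le_rpow_of_exponent_ge ht ht1 (by linarith)
  have hsplit := gaussConv_eq_add_sub ht (gaussDeriv t (gaussDeriv t 1)) hmeas hM (G s) s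
  rw [gaussConv_gaussDeriv_exp ht, gaussConv_gaussDeriv_exp ht] at hsplit
  have hx1 : x * deriv (bHeatOp t f) x = _ := hE1 x hx
  have hx2 : xDdx^[2] (bHeatOp t f) x = _ := hE2 x hx
  have hxw : x ^ (-w) * Real.exp (w * s) = 1 := by
    rw [hs, mul_comm w, ← Real.rpow_def_of_pos hx, ← Real.rpow_add hx]
    simp
  rw [hE0 x hx, hx1, hx2, abs_mul, abs_mul, abs_mul, abs_of_nonneg hN0]
  set e := Real.exp (w * s) with he
  have he0 : 0 < e := Real.exp_pos _
  have c0 : N * |gaussConv t 1 φ s| ≤ C * S * T * e :=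
    b0.trans (by nlinarith [mul_le_mul_of_nonneg_left hT1 (by positivity : 0 ≤ C * S * e)])
  have c1 : N * |gaussConv t (gaussDeriv t 1) φ s| ≤ C * S * T * e :=
    b1.trans (by gcongr)
  have c2 : N * |gaussConv t (gaussDeriv t (gaussDeriv t 1)) φ s| ≤
      C * (w ^ 2 * S + K) * T * e := by
    rw [hsplit]
    set J := gaussConv t 1 (fun u => Real.exp (w * u)) s
    set Q := gaussConv t (gaussDeriv t (gaussDeriv t 1)) (fun u => φ u - G s * Real.exp (w * u)) s
    calc _ ≤ N * (|G s * (w * (w * J))| + |Q|) :=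
          mul_le_mul_of_nonneg_left (abs_add_le _ _) hN0
      _ = |G s| * (w ^ 2 * (N * |J|)) + N * |Q| := by
          rw [abs_mul (G s), ← mul_assoc w, abs_mul (w * w), ← sq, abs_of_nonneg (sq_nonneg w)]; ring
      _ ≤ S * (w ^ 2 * (C * T * e)) + C * K * T * e := by
          refine add_le_add (mul_le_mul (hGS s) (mul_le_mul_of_nonneg_left (be.trans ?_)
            (sq_nonneg w)) (by positivity) hS0) b2
          nlinarith [mul_le_mul_of_nonneg_left hT1 (by positivity : 0 ≤ C * e)]
      _ = _ := by ring
  calc _ ≤ x ^ (-w) * (C * S * T * e + C * S * T * e + C * (w ^ 2 * S + K) * T * e) :=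
        mul_le_mul_of_nonneg_left (add_le_add (add_le_add c0 c1) c2) (by positivity)
    _ = C * T * ((2 + w ^ 2) * S + K) * (x ^ (-w) * e) := by ring
    _ = C * T * ((2 + w ^ 2) * S + K) := by rw [hxw, mul_one]
    _ ≤ C * T * ((3 + w ^ 2) * (S + K)) := by
        gcongr
        nlinarith [mul_nonneg (sq_nonneg w) hK0]
    _ = _ := by ring
end

section
/- Let m ≥ 1, let f : ℝ^m → ℝ be bounded and uniformly continuous, and let Q : ℝ → ℝ be Lipschitz on bounded sets (for every r > 0 there is L with |Q(a) − Q(b)| ≤ L|a − b| whenever |a|, |b| ≤ r). Then there exist T > 0 and a function u : [0,T] × ℝ^m → ℝ such that: (i) u(0,·) = f; (ii) each u(t,·) is bounded and continuous, with sup_{t∈[0,T], x} |u(t,x)| < ∞; (iii) t ↦ u(t,·) is continuous in the sup-norm, i.e. sup_x |u(t,x) − u(t₀,x)| → 0 as t → t₀, for every t₀ ∈ [0,T]; and (iv) for all t ∈ [0,T] and x ∈ ℝ^m, u(t,x) = (P_t f)(x) + ∫₀^t P_{t−s}( y ↦ Q(u(s,y)) )(x) ds. That is, the semilinear heat equation ∂_t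 u − Δu = Q(u), u(0) = f, has a short-time mild solution. -/
open MeasureTheory Set

/-- The Euclidean heat semigroup: `(P_t f)(x) = ∫ H_t(x,y) f(y) dy` for `t > 0`, and
`P_0 = id` (extended as the identity for `t ≤ 0`). -/
noncomputable def heatSemigroup (m : ℕ) (t : ℝ) (f : EuclideanSpace ℝ (Fin m) → ℝ)
    (x : EuclideanSpace ℝ (Fin m)) : ℝ :=
  if t ≤ 0 then f x else ∫ y, heatKernel m t x y * f y

open Topology Filter in
lemma uniformContinuous_integral_of_bound {A W : Type*} [UniformSpace A]
    [(uniformity A).IsCountablyGenerated] [MeasurableSpace W] {μ : Measure W} [IsFiniteMeasure μ]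
    {F : A → W → ℝ} {C : ℝ} (hmeas : ∀ a, AEStronglyMeasurable (F a) μ)
    (hbound : ∀ a w, |F a w| ≤ C) (hF : ∀ w, UniformContinuous fun a => F a w) :
    UniformContinuous fun a => ∫ w, F a w ∂μ := by
  have hint : ∀ a, Integrable (F a) μ := fun a =>
    Integrable.of_bound (hmeas a) C (ae_of_all _ (hbound a))
  have key : ∀ g : A → ℝ, UniformContinuous g ↔
      Tendsto (fun p : A × A => g p.2 - g p.1) (uniformity A) (𝓝 0) := fun g => by
    rw [UniformContinuous, uniformity_eq_comap_nhds_zero ℝ, tendsto_comap_iff]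
    rfl
  rw [key]
  simp_rw [← integral_sub (hint _) (hint _)]
  rw [← integral_zero W ℝ (μ := μ)]
  refine tendsto_integral_filter_of_dominated_convergence (fun _ => C + C) ?_ ?_
    (integrable_const _) ?_
  · exact Eventually.of_forall fun p => (hmeas _).sub (hmeas _)
  · exact Eventually.of_forall fun p => ae_of_all _ fun w =>
      (norm_sub_le _ _).trans (add_le_add (hbound _ _) (hbound _ _))
  · exact ae_of_all _ fun w => (key _).1 (hF w)

lemma integral_heatKernel_one (m : ℕ) : ∫ z, heatKernel m 1 0 z = 1 := by
  have h4 : (0 : ℝ) < 4 * Real.pi := by positivity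
  have h := GaussianFourier.integral_rexp_neg_mul_sq_norm
    (V := EuclideanSpace ℝ (Fin m)) (b := 1 / 4) (by norm_num)
  have hk : ∀ z : EuclideanSpace ℝ (Fin m), heatKernel m 1 0 z =
      (4 * Real.pi) ^ (-(m : ℝ) / 2) * Real.exp (-(1 / 4) * ‖z‖ ^ 2) := fun z => by
    simp only [heatKernel, zero_sub, norm_neg, mul_one]
    congr 2
    ring
  simp_rw [hk]
  rw [integral_const_mul, h, finrank_euclideanSpace_fin,
    show Real.pi / (1 / 4) = 4 * Real.pi by ring, ← Real.rpow_add h4]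
  simp [neg_div]

lemma continuous_heatKernel_one (m : ℕ) : Continuous (heatKernel m 1 0) := by
  unfold heatKernel
  fun_prop

lemma heatKernel_one_nonneg (m : ℕ) (z : EuclideanSpace ℝ (Fin m)) : 0 ≤ heatKernel m 1 0 z := by
  unfold heatKernel
  positivity

/-- The Gaussian measure on `ℝ^m` with density `H_1(0, ·)`. -/
noncomputable def heatMeasure (m : ℕ) : Measure (EuclideanSpace ℝ (Fin m)) :=
  volume.withDensity fun z => ENNReal.ofReal (heatKernel m 1 0 z)

instance isProbabilityMeasure_heatMeasure (m : ℕ) : IsProbabilityMeasure (heatMeasure m) := by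
  have hint : Integrable (heatKernel m 1 0) :=
    not_imp_comm.1 integral_undef (by simp [integral_heatKernel_one])
  constructor
  rw [heatMeasure, withDensity_apply _ MeasurableSet.univ, Measure.restrict_univ,
    ← ofReal_integral_eq_lintegral_ofReal hint (ae_of_all _ (heatKernel_one_nonneg m)),
    integral_heatKernel_one, ENNReal.ofReal_one]

lemma heatSemigroup_eq_integral_heatMeasure (m : ℕ) (t : ℝ) (f : EuclideanSpace ℝ (Fin m) → ℝ)
    (x : EuclideanSpace ℝ (Fin m)) :
    heatSemigroup m t f x = ∫ z, f (x + √t • z) ∂heatMeasure m := by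
  unfold heatSemigroup
  split_ifs with ht
  · simp [Real.sqrt_eq_zero_of_nonpos ht]
  · push Not at ht
    have hs : 0 < √t := Real.sqrt_pos.2 ht
    rw [heatMeasure, integral_withDensity_eq_integral_toReal_smul
      (continuous_heatKernel_one m).measurable.ennreal_ofReal (by simp),
      ← integral_add_left_eq_self _ x]
    have h := Measure.integral_comp_smul_of_nonneg volume
      (fun y : EuclideanSpace ℝ (Fin m) => heatKernel m t x (x + y) * f (x + y)) √t
      (hR := hs.le)
    rw [eq_inv_smul_iff₀ (by positivity), ← integral_smul] at h
    rw [← h]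
    refine integral_congr_ae (ae_of_all _ fun z => ?_)
    have hk : √t ^ m * heatKernel m t x (x + √t • z) = heatKernel m 1 0 z := by
      have hpow : √t ^ m * t ^ (-(m : ℝ) / 2) = 1 := by
        rw [Real.sqrt_eq_rpow, ← Real.rpow_mul_natCast ht.le, ← Real.rpow_add ht]
        ring_nf
        simp
      have hexp : -‖√t • z‖ ^ 2 / (4 * t) = -‖z‖ ^ 2 / (4 * 1) := by
        rw [norm_smul, Real.norm_of_nonneg hs.le, mul_pow, Real.sq_sqrt ht.le]
        field_simp
      simp only [heatKernel, sub_add_cancel_left, norm_neg, zero_sub, hexp]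
      rw [Real.mul_rpow (by positivity) ht.le, mul_one (4 * Real.pi)]
      rw [mul_assoc, mul_left_comm, ← mul_assoc (√t ^ m), hpow, one_mul]
    simp only [finrank_euclideanSpace_fin, smul_eq_mul,
      ENNReal.toReal_ofReal (heatKernel_one_nonneg m z)]
    rw [← hk, mul_assoc]

lemma uniformContinuous_comp_projIcc {a b : ℝ} (h : a ≤ b) {X : Type*} [UniformSpace X]
    {g : ℝ → X} (hg : Continuous g) : UniformContinuous fun t : ℝ => g (projIcc a b h t) :=
  (CompactSpace.uniformContinuous_of_continuous (hg.comp continuous_subtype_val)).comp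
    (LipschitzWith.projIcc h).uniformContinuous

lemma uniformContinuous_mul_of_bounded {A : Type*} [UniformSpace A] {f g : A → ℝ} {C D : ℝ}
    (hf : UniformContinuous f) (hg : UniformContinuous g) (hfC : ∀ a, |f a| ≤ C)
    (hgD : ∀ a, |g a| ≤ D) : UniformContinuous fun a => f a * g a :=
  (Real.uniformContinuous_mul {p | |p.1| < C + 1 ∧ |p.2| < D + 1} fun _ h => h).comp
    ((hf.prodMk hg).subtype_mk fun a =>
      ⟨(hfC a).trans_lt (lt_add_one C), (hgD a).trans_lt (lt_add_one D)⟩)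

/-- The right-hand side of the Duhamel formula on `[0, T]`, after the substitutions
`s = t (1 - r)` and `y = x + √(t r) z`, with the time variable clamped to `[0, T]`. -/
noncomputable def duhamelMap (m : ℕ) {T : ℝ} (hT : 0 ≤ T) (f : EuclideanSpace ℝ (Fin m) → ℝ)
    (Q : ℝ → ℝ) (u : ℝ × EuclideanSpace ℝ (Fin m) → ℝ) (p : ℝ × EuclideanSpace ℝ (Fin m)) : ℝ :=
  ∫ z, f (p.2 + √(projIcc 0 T hT p.1 : ℝ) • z) ∂heatMeasure m +
    (projIcc 0 T hT p.1 : ℝ) *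
      ∫ w, Q (u ((projIcc 0 T hT p.1 : ℝ) * (1 - w.1),
        p.2 + √((projIcc 0 T hT p.1 : ℝ) * w.1) • w.2))
        ∂(volume.restrict (Ioc (0 : ℝ) 1)).prod (heatMeasure m)

section Duhamel

variable {m : ℕ} {T : ℝ} {f : EuclideanSpace ℝ (Fin m) → ℝ} {Q : ℝ → ℝ}

instance isProbabilityMeasure_restrict_Ioc_zero_one :
    IsProbabilityMeasure ((volume : Measure ℝ).restrict (Ioc (0 : ℝ) 1)) :=
  ⟨by simp⟩

lemma abs_integral_le_of_isProbabilityMeasure {W : Type*} [MeasurableSpace W] {μ : Measure W}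
    [IsProbabilityMeasure μ] {g : W → ℝ} {C : ℝ} (h : ∀ w, |g w| ≤ C) : |∫ w, g w ∂μ| ≤ C := by
  simpa using norm_integral_le_of_norm_le_const (μ := μ) (f := g) (ae_of_all _ h)

lemma abs_duhamelMap_le (hT : 0 ≤ T) {M B : ℝ} (hf : ∀ x, |f x| ≤ M) (hQ : ∀ a, |Q a| ≤ B)
    (u : ℝ × EuclideanSpace ℝ (Fin m) → ℝ) (p : ℝ × EuclideanSpace ℝ (Fin m)) :
    |duhamelMap m hT f Q u p| ≤ M + T * B := by
  unfold duhamelMap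
  refine (abs_add_le _ _).trans (add_le_add
    (abs_integral_le_of_isProbabilityMeasure fun _ => hf _) ?_)
  rw [abs_mul, abs_of_nonneg (projIcc 0 T hT p.1).2.1]
  exact mul_le_mul (projIcc 0 T hT p.1).2.2
    (abs_integral_le_of_isProbabilityMeasure fun _ => hQ _) (abs_nonneg _) hT

lemma uniformContinuous_duhamelMap (hT : 0 ≤ T) {M B : ℝ} (hf : ∀ x, |f x| ≤ M)
    (hfc : UniformContinuous f) (hQ : ∀ a, |Q a| ≤ B) (hQc : UniformContinuous Q)
    {u : ℝ × EuclideanSpace ℝ (Fin m) → ℝ} (hu : UniformContinuous u) :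
    UniformContinuous (duhamelMap m hT f Q u) := by
  have hcomp : ∀ {X : Type} [UniformSpace X] {g : ℝ → X}, Continuous g →
      UniformContinuous fun p : ℝ × EuclideanSpace ℝ (Fin m) => g (projIcc 0 T hT p.1) :=
    fun hg => (uniformContinuous_comp_projIcc hT hg).comp uniformContinuous_fst
  unfold duhamelMap
  refine UniformContinuous.add ?_ (uniformContinuous_mul_of_bounded (C := T) (D := B)
    (hcomp continuous_id) ?_ (fun p => ?_)
    fun p => abs_integral_le_of_isProbabilityMeasure fun _ => hQ _)
  · refine uniformContinuous_integral_of_bound (C := M) (fun p => ?_) (fun _ _ => hf _) fun z => ?_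
    · have := hfc.continuous
      exact Continuous.aestronglyMeasurable (by fun_prop)
    · exact hfc.comp (uniformContinuous_snd.add (hcomp (g := fun t => √t • z) (by fun_prop)))
  · refine uniformContinuous_integral_of_bound (C := B) (fun p => ?_) (fun _ _ => hQ _) fun w => ?_
    · have := hQc.continuous
      have := hu.continuous
      exact Continuous.aestronglyMeasurable (by fun_prop)
    · exact hQc.comp (hu.comp ((hcomp (g := fun t => t * (1 - w.1)) (by fun_prop)).prodMk
        (uniformContinuous_snd.add (hcomp (g := fun t => √(t * w.1) • w.2) (by fun_prop)))))
  · rw [abs_of_nonneg (projIcc 0 T hT p.1).2.1]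
    exact (projIcc 0 T hT p.1).2.2

lemma abs_duhamelMap_sub_le (hT : 0 ≤ T) {B : ℝ} {L : NNReal} (hQ : ∀ a, |Q a| ≤ B)
    (hQL : LipschitzWith L Q) {u v : ℝ × EuclideanSpace ℝ (Fin m) → ℝ} (hu : Continuous u)
    (hv : Continuous v) {D : ℝ} (huv : ∀ p, |u p - v p| ≤ D)
    (p : ℝ × EuclideanSpace ℝ (Fin m)) :
    |duhamelMap m hT f Q u p - duhamelMap m hT f Q v p| ≤ T * L * D := by
  have hQc := hQL.continuous
  unfold duhamelMap
  rw [add_sub_add_left_eq_sub, ← mul_sub, ← integral_sub, abs_mul,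
    abs_of_nonneg (projIcc 0 T hT p.1).2.1, mul_assoc]
  · refine mul_le_mul (projIcc 0 T hT p.1).2.2
      (abs_integral_le_of_isProbabilityMeasure fun w => ?_) (abs_nonneg _) hT
    exact (hQL.dist_le_mul _ _).trans (mul_le_mul_of_nonneg_left (huv _) L.2)
  all_goals
    refine Integrable.of_bound (C := B) ?_ (ae_of_all _ fun _ => hQ _)
    exact Continuous.aestronglyMeasurable (by fun_prop)

lemma duhamelMap_eq (hT : 0 ≤ T) {B : ℝ} (hQ : ∀ a, |Q a| ≤ B) (hQc : Continuous Q)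
    {u : ℝ × EuclideanSpace ℝ (Fin m) → ℝ} (hu : Continuous u) {t : ℝ} (ht : t ∈ Icc 0 T)
    (x : EuclideanSpace ℝ (Fin m)) :
    duhamelMap m hT f Q u (t, x) = heatSemigroup m t f x +
      ∫ s in (0 : ℝ)..t, heatSemigroup m (t - s) (fun y => Q (u (s, y))) x := by
  unfold duhamelMap
  simp only [projIcc_of_mem hT ht, heatSemigroup_eq_integral_heatMeasure]
  rw [integral_prod _ (Integrable.of_bound (C := B)
    (Continuous.aestronglyMeasurable (by fun_prop)) (ae_of_all _ fun _ => hQ _)),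
    ← intervalIntegral.integral_of_le zero_le_one]
  have h := intervalIntegral.smul_integral_comp_sub_mul (a := 0) (b := 1)
    (fun s => ∫ z, Q (u (s, x + √(t - s) • z)) ∂heatMeasure m) t t
  simp only [mul_one, mul_zero, sub_self, sub_zero, sub_sub_cancel, smul_eq_mul] at h
  rw [← h]
  simp only [mul_sub, mul_one]

open BoundedContinuousFunction in
lemma exists_isFixedPt_duhamelMap (hT : 0 ≤ T) {M B : ℝ} {L : NNReal} (hf : ∀ x, |f x| ≤ M)
    (hfc : UniformContinuous f) (hQ : ∀ a, |Q a| ≤ B) (hQL : LipschitzWith L Q)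
    (hTL : T * L < 1) :
    ∃ u : ℝ × EuclideanSpace ℝ (Fin m) → ℝ, UniformContinuous u ∧ duhamelMap m hT f Q u = u := by
  let S : Set ((ℝ × EuclideanSpace ℝ (Fin m)) →ᵇ ℝ) := {u | UniformContinuous u}
  have hS : IsClosed S := isClosed_of_closure_subset fun u hu => by
    obtain ⟨v, hv, hvu⟩ := mem_closure_iff_seq_limit.1 hu
    exact (tendsto_iff_tendstoUniformly.1 hvu).uniformContinuous
      (Filter.Frequently.of_forall hv)
  have : CompleteSpace S := hS.completeSpace_coe
  have : Nonempty S := ⟨0, uniformContinuous_const⟩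
  have hUC : ∀ u : S, UniformContinuous (duhamelMap m hT f Q u.1) := fun u =>
    uniformContinuous_duhamelMap hT hf hfc hQ hQL.uniformContinuous u.2
  let Φ : S → S := fun u => ⟨.ofNormedAddCommGroup _ (hUC u).continuous _
    (abs_duhamelMap_le hT hf hQ u.1), hUC u⟩
  have hΦ : ContractingWith (⟨T, hT⟩ * L) Φ := by
    refine ⟨NNReal.coe_lt_coe.1 hTL, LipschitzWith.of_dist_le_mul fun u v => ?_⟩
    refine (dist_le (by positivity)).2 fun p => ?_
    exact abs_duhamelMap_sub_le hT hQ hQL u.1.continuous v.1.continuous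
      (fun q => dist_coe_le_dist (f := u.1) (g := v.1) q) p
  refine ⟨hΦ.fixedPoint.1, hΦ.fixedPoint.2, ?_⟩
  exact congrArg (fun u : S => (u.1 : ℝ × EuclideanSpace ℝ (Fin m) → ℝ)) hΦ.fixedPoint_isFixedPt

end Duhamel

lemma exists_lipschitzWith_bounded_eqOn {Q : ℝ → ℝ} {R : ℝ} (hR : 0 ≤ R)
    (hQ : ∃ L : ℝ, ∀ a b : ℝ, |a| ≤ R → |b| ≤ R → |Q a - Q b| ≤ L * |a - b|) :
    ∃ (Q' : ℝ → ℝ) (L : NNReal) (B : ℝ), LipschitzWith L Q' ∧ (∀ a, |Q' a| ≤ B) ∧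
      ∀ a, |a| ≤ R → Q' a = Q a := by
  obtain ⟨L, hL⟩ := hQ
  have hRR : -R ≤ R := by linarith
  have hLip : LipschitzWith L.toNNReal fun a : Icc (-R) R => Q a :=
    LipschitzWith.of_dist_le_mul fun a b =>
      (hL a b (abs_le.2 a.2) (abs_le.2 b.2)).trans
        (mul_le_mul_of_nonneg_right (Real.le_coe_toNNReal L) (abs_nonneg _))
  obtain ⟨B, hB⟩ := (isCompact_univ.image hLip.continuous).isBounded.exists_norm_le
  refine ⟨fun a => Q (projIcc (-R) R hRR a), L.toNNReal * 1, B,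
    hLip.comp (LipschitzWith.projIcc hRR), fun a => hB _ ⟨_, mem_univ _, rfl⟩, fun a ha => ?_⟩
  simp only [projIcc_of_mem hRR (abs_le.1 ha)]

/-- **Short-time existence of a mild solution of `∂_t u − Δu = Q(u)` (Euclidean model).**
For `f` bounded and uniformly continuous and `Q : ℝ → ℝ` Lipschitz on bounded sets there
exist `T > 0` and `u : [0,T] × ℝ^m → ℝ` with `u(0,·) = f`, each `u(t,·)` bounded and
continuous with a uniform bound, `t ↦ u(t,·)` continuous in sup-norm, and
`u(t,x) = (P_t f)(x) + ∫₀^t P_{t−s}(Q ∘ u(s,·))(x) ds`. -/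
theorem semilinear_heat_short_time_existence (m : ℕ) (hm : 1 ≤ m)
    (f : EuclideanSpace ℝ (Fin m) → ℝ)
    (hfb : ∃ M : ℝ, ∀ x, |f x| ≤ M)
    (hfc : UniformContinuous f)
    (Q : ℝ → ℝ)
    (hQ : ∀ r > (0:ℝ), ∃ L : ℝ, ∀ a b : ℝ, |a| ≤ r → |b| ≤ r → |Q a - Q b| ≤ L * |a - b|) :
    ∃ T > (0:ℝ), ∃ u : ℝ → EuclideanSpace ℝ (Fin m) → ℝ,
      u 0 = f ∧
      (∃ M : ℝ, ∀ t ∈ Icc (0:ℝ) T, ∀ x, |u t x| ≤ M) ∧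
      (∀ t ∈ Icc (0:ℝ) T, Continuous (u t)) ∧
      (∀ t₀ ∈ Icc (0:ℝ) T, ∀ ε > (0:ℝ), ∃ δ > (0:ℝ), ∀ t ∈ Icc (0:ℝ) T,
        |t - t₀| < δ → ∀ x, |u t x - u t₀ x| ≤ ε) ∧
      (∀ t ∈ Icc (0:ℝ) T, ∀ x,
        u t x = heatSemigroup m t f x +
          ∫ s in (0:ℝ)..t, heatSemigroup m (t - s) (fun y => Q (u s y)) x) := by
  obtain ⟨M, hM⟩ := hfb
  have hM0 : 0 ≤ M := (abs_nonneg _).trans (hM 0)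
  obtain ⟨Q', L, B, hL, hB, hQQ'⟩ :=
    exists_lipschitzWith_bounded_eqOn (R := M + 1) (by positivity) (hQ (M + 1) (by positivity))
  have hB0 : 0 ≤ B := (abs_nonneg _).trans (hB 0)
  have hden : 0 < L + B + 1 := by positivity
  set T : ℝ := 1 / (L + B + 1)
  have hT : 0 < T := by positivity
  have hTL : T * L < 1 := by
    rw [one_div_mul_eq_div, div_lt_one hden]
    linarith
  have hTB : T * B ≤ 1 := by
    rw [one_div_mul_eq_div, div_le_one hden]
    linarith [L.coe_nonneg]
  obtain ⟨u, huc, hu⟩ := exists_isFixedPt_duhamelMap hT.le hM hfc hB hL hTL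
  have hub : ∀ p, |u p| ≤ M + 1 := fun p => by
    have h := abs_duhamelMap_le hT.le hM hB u p
    rw [hu] at h
    linarith
  have hmild : ∀ t ∈ Icc (0:ℝ) T, ∀ x, u (t, x) = heatSemigroup m t f x +
      ∫ s in (0:ℝ)..t, heatSemigroup m (t - s) (fun y => Q (u (s, y))) x := fun t ht x => by
    have h := duhamelMap_eq (f := f) hT.le hB hL.continuous huc.continuous ht x
    simpa only [hu, hQQ' _ (hub _)] using h
  refine ⟨T, hT, fun t x => u (t, x), ?_, ⟨M + 1, fun t _ x => hub (t, x)⟩,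
    fun t _ => huc.continuous.comp (by fun_prop), fun t₀ _ ε hε => ?_, hmild⟩
  · funext x
    simp [hmild 0 ⟨le_rfl, hT.le⟩ x, heatSemigroup]
  · obtain ⟨δ, hδ, h⟩ := Metric.uniformContinuous_iff.1 huc ε hε
    refine ⟨δ, hδ, fun t _ htt x => (h ?_).le⟩
    simpa [Prod.dist_eq, Real.dist_eq, hδ] using htt
end
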